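/- (Routing labeling scheme for cube-free median graphs.) There exist a constant C > 0 and a decoding function D : (List Bool) × (List Bool) → ℕ such that for every finite cube-free median graph G on n ≥ 2 vertices equipped with any port assignment p (a function assigning to each ordered pair (u,w) of adjacent vertices a number p(u,w) ∈ {1,…,deg(u)} so that p(u,·) is injective on the neighbors of u), there is a labeling ℓ assigning to each vertex v a Boolean string of length at most C·(log₂ n)³ such that for all distinct vertices u, v there exists a neighbor w of u with d_G(w,v) = d_G(u,v) − 1 and D(ℓ(u), ℓ(v)) = p(u,w). -/

import Mathlib

open SimpleGraph Set

/-- The metric interval `I(u,v)` in a graph `G`. -/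
def gInterval {V : Type*} (G : SimpleGraph V) (u v : V) : Set V :=
  {w | G.dist u w + G.dist w v = G.dist u v}

/-- A median graph: a connected graph in which every triplet of vertices has a
unique median, i.e. a unique vertex in `I(x,y) ∩ I(y,z) ∩ I(z,x)`. -/
def MedianGraph {V : Type*} (G : SimpleGraph V) : Prop :=
  G.Connected ∧ ∀ x y z : V,
    ∃! m : V, m ∈ gInterval G x y ∧ m ∈ gInterval G y z ∧ m ∈ gInterval G z x

/-- `G` contains an induced `d`-dimensional hypercube all of whose vertices lie in `S`. -/
def HasCubeIn {V : Type*} (G : SimpleGraph V) (d : ℕ) (S : Set V) : Prop :=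
  ∃ f : Finset (Fin d) → V, Function.Injective f ∧ (∀ A, f A ∈ S) ∧
    ∀ A B : Finset (Fin d), G.Adj (f A) (f B) ↔ (symmDiff A B).card = 1

/-- `G` contains an induced `d`-dimensional hypercube `Q_d`. -/
def HasInducedCube {V : Type*} (G : SimpleGraph V) (d : ℕ) : Prop :=
  HasCubeIn G d Set.univ

/-- A cube-free (median) graph: no induced 3-dimensional hypercube. -/
def CubeFree {V : Type*} (G : SimpleGraph V) : Prop :=
  ¬ HasInducedCube G 3

/-- `g` is a gate of `v` in the set `S`. -/
def IsGate {V : Type*} (G : SimpleGraph V) (S : Set V) (v g : V) : Prop :=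
  g ∈ S ∧ ∀ u ∈ S, G.dist v u = G.dist v g + G.dist g u

/-- A set of vertices is gated if every vertex has a gate in it. -/
def Gated {V : Type*} (G : SimpleGraph V) (S : Set V) : Prop :=
  ∀ v : V, ∃ g : V, IsGate G S v g

/-- A set of vertices is convex if it contains the interval between any two of its members. -/
def GConvex {V : Type*} (G : SimpleGraph V) (S : Set V) : Prop :=
  ∀ u ∈ S, ∀ v ∈ S, gInterval G u v ⊆ S

/-- The star `St(z)`: the set of vertices lying in some induced hypercube of `G`
containing `z`. -/
def gStar {V : Type*} (G : SimpleGraph V) (z : V) : Set V :=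
  {v | ∃ (d : ℕ) (f : Finset (Fin d) → V), Function.Injective f ∧
      (∀ A B : Finset (Fin d), G.Adj (f A) (f B) ↔ (symmDiff A B).card = 1) ∧
      (∃ A, f A = z) ∧ (∃ A, f A = v)}

/-- The fiber `F(x)` of `x` with respect to a (gated) set `H`: all vertices having `x`
as their gate in `H`. -/
def fiber {V : Type*} (G : SimpleGraph V) (H : Set V) (x : V) : Set V :=
  {v | IsGate G H v x}

/-- Two fibers are neighboring when an edge of `G` joins them. -/
def Neighboring {V : Type*} (G : SimpleGraph V) (H : Set V) (x y : V) : Prop :=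
  ∃ a ∈ fiber G H x, ∃ b ∈ fiber G H y, G.Adj a b

/-- The boundary `∂_y F(x)`: vertices of `F(x)` having a neighbor in `F(y)`. -/
def bdry {V : Type*} (G : SimpleGraph V) (H : Set V) (x y : V) : Set V :=
  {a | a ∈ fiber G H x ∧ ∃ b ∈ fiber G H y, G.Adj a b}

/-- The total boundary `∂*F(x)`: union of the boundaries `∂_y F(x)` over all `y ∈ H`
adjacent to `x`. -/
def totalBdry {V : Type*} (G : SimpleGraph V) (H : Set V) (x : V) : Set V :=
  ⋃ (y : V) (_ : y ∈ H ∧ G.Adj x y), bdry G H x y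

/-- The imprint set of `u` on `A`. -/
def imprints {V : Type*} (G : SimpleGraph V) (u : V) (A : Set V) : Set V :=
  {a ∈ A | gInterval G u a ∩ A = {a}}

/-- The halfspace `W(u,v)` associated with an edge `uv`. -/
def halfspaceW {V : Type*} (G : SimpleGraph V) (u v : V) : Set V :=
  {z | G.dist z u < G.dist z v}


section MedianBasics

variable {V : Type*} {G : SimpleGraph V}

lemma mem_gInt {u v w : V} : w ∈ gInterval G u v ↔ G.dist u w + G.dist w v = G.dist u v := Iff.rfl

lemma step_exists (hc : G.Connected) {u v : V} (h : u ≠ v) :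
    ∃ w, G.Adj u w ∧ G.dist w v + 1 = G.dist u v := by
  obtain ⟨q, hq⟩ := hc.exists_walk_length_eq_dist u v
  cases q with
  | nil => exact absurd rfl h
  | cons hadj q' =>
    rename_i w
    refine ⟨w, hadj, ?_⟩
    rw [SimpleGraph.Walk.length_cons] at hq
    have h1 := SimpleGraph.dist_le q'
    have h2 := hc.dist_triangle (u := u) (v := w) (w := v)
    have h3 : G.dist u w = 1 := SimpleGraph.dist_eq_one_iff_adj.2 hadj
    omega

lemma adj_dist_ne (hM : MedianGraph G) {x y : V} (h : G.Adj x y) (v : V) :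
    G.dist v x ≠ G.dist v y := by
  obtain ⟨m, ⟨h1, h2, h3⟩, -⟩ := hM.2 v x y
  rw [mem_gInt] at h1 h2 h3
  have hxy : G.dist x y = 1 := SimpleGraph.dist_eq_one_iff_adj.2 h
  have e1 := G.dist_comm (u := y) (v := m)
  have e2 := G.dist_comm (u := x) (v := m)
  have e3 := G.dist_comm (u := y) (v := v)
  have e4 := G.dist_comm (u := m) (v := v)
  omega

lemma adj_dist_cases (hM : MedianGraph G) {x y : V} (h : G.Adj x y) (v : V) :
    G.dist v x = G.dist v y + 1 ∨ G.dist v y = G.dist v x + 1 := by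
  have h1 := adj_dist_ne hM h v
  have hxy : G.dist x y = 1 := SimpleGraph.dist_eq_one_iff_adj.2 h
  have h2 := hM.1.dist_triangle (u := v) (v := x) (w := y)
  have h3 := hM.1.dist_triangle (u := v) (v := y) (w := x)
  rw [G.dist_comm (u := y) (v := x)] at h3
  omega

/-- quadrangle -/
lemma quad (hM : MedianGraph G) {w x y o : V} (hx : G.Adj w x) (hy : G.Adj w y) (hne : x ≠ y)
    (dx : G.dist x o + 1 = G.dist w o) (dy : G.dist y o + 1 = G.dist w o) :
    ∃ s, G.Adj s x ∧ G.Adj s y ∧ G.dist s o + 1 = G.dist x o ∧ G.dist s o + 1 = G.dist y o := by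
  obtain ⟨m, ⟨h1, h2, h3⟩, -⟩ := hM.2 x y o
  rw [mem_gInt] at h1 h2 h3
  have hwx : G.dist w x = 1 := SimpleGraph.dist_eq_one_iff_adj.2 hx
  have hwy : G.dist w y = 1 := SimpleGraph.dist_eq_one_iff_adj.2 hy
  have t := hM.1.dist_triangle (u := x) (v := w) (w := y)
  have p : 0 < G.dist x y := hM.1.pos_dist_of_ne hne
  have n1 := adj_dist_ne hM hy x
  have e1 := G.dist_comm (u := x) (v := w)
  have e2 := G.dist_comm (u := o) (v := m)
  have e3 := G.dist_comm (u := m) (v := x)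
  have e4 := G.dist_comm (u := m) (v := y)
  have e5 := G.dist_comm (u := o) (v := x)
  refine ⟨m, SimpleGraph.dist_eq_one_iff_adj.1 ?_, SimpleGraph.dist_eq_one_iff_adj.1 ?_, ?_, ?_⟩ <;> omega

lemma dist_two (hM : MedianGraph G) {w x y : V} (hx : G.Adj w x) (hy : G.Adj w y) (hne : x ≠ y) :
    G.dist x y = 2 := by
  have hwx : G.dist w x = 1 := SimpleGraph.dist_eq_one_iff_adj.2 hx
  have hwy : G.dist w y = 1 := SimpleGraph.dist_eq_one_iff_adj.2 hy
  have t := hM.1.dist_triangle (u := x) (v := w) (w := y)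
  have p : 0 < G.dist x y := hM.1.pos_dist_of_ne hne
  have n1 := adj_dist_ne hM hy x
  have e1 := G.dist_comm (u := x) (v := w)
  omega

lemma k23_free (hM : MedianGraph G) {s t x y z : V} (hxy : x ≠ y) (hyz : y ≠ z) (hzx : z ≠ x)
    (sx : G.Adj s x) (sy : G.Adj s y) (sz : G.Adj s z)
    (tx : G.Adj t x) (ty : G.Adj t y) (tz : G.Adj t z) : s = t := by
  have key : ∀ s, G.Adj s x → G.Adj s y → G.Adj s z →
      (s ∈ gInterval G x y ∧ s ∈ gInterval G y z ∧ s ∈ gInterval G z x) := by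
    intro s sx sy sz
    simp only [mem_gInt]
    rw [dist_two hM sx sy hxy, dist_two hM sy sz hyz, dist_two hM sz sx hzx,
      SimpleGraph.dist_eq_one_iff_adj.2 sx, SimpleGraph.dist_eq_one_iff_adj.2 sy,
      SimpleGraph.dist_eq_one_iff_adj.2 sz, SimpleGraph.dist_eq_one_iff_adj.2 sx.symm,
      SimpleGraph.dist_eq_one_iff_adj.2 sy.symm, SimpleGraph.dist_eq_one_iff_adj.2 sz.symm]
    simp
  exact (hM.2 x y z).unique (key s sx sy sz) (key t tx ty tz)

lemma mem_W {u v z : V} : z ∈ halfspaceW G u v ↔ G.dist z u < G.dist z v := Iff.rfl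

lemma not_mem_W (hM : MedianGraph G) {u v z : V} (h : G.Adj u v) :
    z ∉ halfspaceW G u v ↔ z ∈ halfspaceW G v u := by
  rw [mem_W, mem_W]
  have := adj_dist_ne hM h z
  omega

lemma W_local (hM : MedianGraph G) {a z x y w : V} (h : G.Adj a z)
    (hx : x ∈ halfspaceW G a z) (hy : y ∈ halfspaceW G a z) (hxy : x ≠ y)
    (wx : G.Adj w x) (wy : G.Adj w y) : w ∈ halfspaceW G a z := by
  by_contra hw
  rw [not_mem_W hM h] at hw
  rw [mem_W] at hx hy hw
  have c1 := adj_dist_cases hM h x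
  have c2 := adj_dist_cases hM h y
  have c3 := adj_dist_cases hM h w
  have c4 := adj_dist_cases hM wx a
  have c5 := adj_dist_cases hM wx z
  have c6 := adj_dist_cases hM wy a
  have c7 := adj_dist_cases hM wy z
  simp only [G.dist_comm (u := a), G.dist_comm (u := z)] at c4 c5 c6 c7
  obtain ⟨s, sx, sy, d1, d2⟩ := quad hM wx wy hxy (o := a) (by omega) (by omega)
  have c8 := adj_dist_cases hM h s
  have c9 := adj_dist_cases hM sx z
  simp only [G.dist_comm (u := z)] at c9
  have key : ∀ s, G.Adj s x → G.Adj s y → G.dist s z + 1 = G.dist x z →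
      (s ∈ gInterval G x y ∧ s ∈ gInterval G y z ∧ s ∈ gInterval G z x) := by
    intro s sx sy h1
    simp only [mem_gInt]
    rw [dist_two hM sx sy hxy,
      SimpleGraph.dist_eq_one_iff_adj.2 sx, SimpleGraph.dist_eq_one_iff_adj.2 sy,
      SimpleGraph.dist_eq_one_iff_adj.2 sx.symm,
      SimpleGraph.dist_eq_one_iff_adj.2 sy.symm, G.dist_comm (u := z), G.dist_comm (u := z)]
    omega
  have := (hM.2 x y z).unique (key s sx sy (by omega)) (key w wx wy (by omega))
  subst this
  omega

lemma W_star (hM : MedianGraph G) {a z x t : V} (h : G.Adj a z)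
    (hx : x ∈ halfspaceW G a z) (ht : t ∈ gInterval G x a) : t ∈ halfspaceW G a z := by
  rw [mem_W] at *
  rw [mem_gInt] at ht
  have := hM.1.dist_triangle (u := x) (v := t) (w := z)
  have c1 := adj_dist_cases hM h x
  omega

lemma W_convex (hM : MedianGraph G) {a z : V} (h : G.Adj a z) :
    GConvex G (halfspaceW G a z) := by
  have main : ∀ k, ∀ x y, G.dist x y = k → x ∈ halfspaceW G a z → y ∈ halfspaceW G a z →
      ∀ w, w ∈ gInterval G x y → w ∈ halfspaceW G a z := by
    intro k
    induction k with
    | zero =>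
      intro x y hk hx hy w hw
      rw [mem_gInt] at hw
      have : G.dist x w = 0 := by omega
      rw [hM.1.dist_eq_zero_iff] at this
      exact this ▸ hx
    | succ k ih =>
      intro x y hk hx hy w hw
      by_cases hwx : x = w
      · exact hwx ▸ hx
      -- first step inside the halfspace
      have hxy : x ≠ y := by rintro rfl; simp at hk
      have first : ∃ x1, G.Adj x x1 ∧ G.dist x1 y + 1 = G.dist x y ∧ x1 ∈ halfspaceW G a z := by
        obtain ⟨m, ⟨h1, h2, h3⟩, -⟩ := hM.2 x y a
        rw [mem_gInt] at h1 h2 h3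
        by_cases hm : x = m
        · subst hm
          obtain ⟨x1, e1, e2⟩ := step_exists hM.1 hxy
          refine ⟨x1, e1, e2, W_star hM h hy ?_⟩
          rw [mem_gInt]
          have e3 := SimpleGraph.dist_eq_one_iff_adj.2 e1
          have t1 := hM.1.dist_triangle (u := y) (v := x1) (w := a)
          have t2 := hM.1.dist_triangle (u := x1) (v := x) (w := a)
          rw [G.dist_comm (u := y) (v := x1)] at *
          rw [G.dist_comm (u := x1) (v := x)] at *
          rw [G.dist_comm (u := y) (v := x)] at *
          omega
        · obtain ⟨x1, e1, e2⟩ := step_exists hM.1 hm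
          have e3 := SimpleGraph.dist_eq_one_iff_adj.2 e1
          have t1 := hM.1.dist_triangle (u := x1) (v := m) (w := a)
          have t2 := hM.1.dist_triangle (u := x) (v := x1) (w := a)
          have t3 := hM.1.dist_triangle (u := x1) (v := m) (w := y)
          have t4 := hM.1.dist_triangle (u := x) (v := x1) (w := y)
          rw [G.dist_comm (u := a), G.dist_comm (u := m) (v := x), G.dist_comm (u := a)] at h3
          refine ⟨x1, e1, by omega, W_star hM h hx ?_⟩
          rw [mem_gInt]
          omega
      obtain ⟨x1, e1, e2, e3⟩ := first
      obtain ⟨w1, f1, f2⟩ := step_exists hM.1 hwx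
      rw [mem_gInt] at hw
      have g1 := SimpleGraph.dist_eq_one_iff_adj.2 f1
      have t1 := hM.1.dist_triangle (u := w1) (v := w) (w := y)
      have t2 := hM.1.dist_triangle (u := x) (v := w1) (w := y)
      have hw1 : w1 ∈ halfspaceW G a z := by
        by_cases hh : w1 = x1
        · exact hh ▸ e3
        obtain ⟨s, s1, s2, s3, s4⟩ := quad hM f1 e1 hh (o := y) (by omega) (by omega)
        have hs : s ∈ halfspaceW G a z := by
          refine ih x1 y (by omega) e3 hy s ?_
          rw [mem_gInt]
          have := SimpleGraph.dist_eq_one_iff_adj.2 s2.symm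
          omega
        refine W_local hM h hx hs ?_ f1.symm s1.symm
        rintro rfl
        omega
      refine ih w1 y (by omega) hw1 hy w ?_
      rw [mem_gInt]
      omega
  intro x hx y hy w hw
  exact main _ x y rfl hx hy w hw

lemma gate_exists (hM : MedianGraph G) {H : Set V} (hH : GConvex G H) (hne : H.Nonempty) (v : V) :
    ∃ g, IsGate G H v g := by
  obtain ⟨g, hg, hmin⟩ : ∃ g ∈ H, ∀ u ∈ H, G.dist v g ≤ G.dist v u := by
    have := WellFounded.has_min (InvImage.wf (fun u => G.dist v u) Nat.lt_wfRel.wf) H hne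
    obtain ⟨g, hg, h⟩ := this
    exact ⟨g, hg, fun u hu => not_lt.1 (h u hu)⟩
  refine ⟨g, hg, fun u hu => ?_⟩
  obtain ⟨m, ⟨h1, h2, h3⟩, -⟩ := hM.2 v g u
  have hm := hmin m (hH g hg u hu h2)
  rw [mem_gInt] at h1 h2 h3
  have : G.dist m g = 0 := by omega
  rw [hM.1.dist_eq_zero_iff] at this
  subst this
  rw [G.dist_comm (u := u), G.dist_comm (u := u), G.dist_comm (u := m) (v := v)] at h3
  omega

end MedianBasics

section CubeLemma

variable {V : Type*} {G : SimpleGraph V}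

lemma finset_fin3 (A : Finset (Fin 3)) : A = ∅ ∨ A = {0} ∨ A = {1} ∨ A = {2} ∨ A = {0, 1} ∨
    A = {0, 2} ∨ A = {1, 2} ∨ A = {0, 1, 2} := by
  revert A; decide

lemma finset_fin3_sep (A B : Finset (Fin 3))
    (h : ∀ C, (symmDiff A C).card = 1 ↔ (symmDiff B C).card = 1) : A = B := by
  revert A B; decide

lemma cube_of (x y0 y1 y2 s01 s02 s12 t : V)
    (a1 : G.Adj x y0) (a2 : G.Adj x y1) (a3 : G.Adj x y2)
    (a4 : G.Adj y0 s01) (a5 : G.Adj y0 s02) (a6 : G.Adj y1 s01) (a7 : G.Adj y1 s12)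
    (a8 : G.Adj y2 s02) (a9 : G.Adj y2 s12)
    (a10 : G.Adj s01 t) (a11 : G.Adj s02 t) (a12 : G.Adj s12 t)
    (n1 : ¬ G.Adj x s01) (n2 : ¬ G.Adj x s02) (n3 : ¬ G.Adj x s12) (n4 : ¬ G.Adj x t)
    (n5 : ¬ G.Adj y0 y1) (n6 : ¬ G.Adj y0 y2) (n7 : ¬ G.Adj y1 y2)
    (n8 : ¬ G.Adj y0 s12) (n9 : ¬ G.Adj y1 s02) (n10 : ¬ G.Adj y2 s01)
    (n11 : ¬ G.Adj y0 t) (n12 : ¬ G.Adj y1 t) (n13 : ¬ G.Adj y2 t)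
    (n14 : ¬ G.Adj s01 s02) (n15 : ¬ G.Adj s01 s12) (n16 : ¬ G.Adj s02 s12) :
    HasInducedCube G 3 := by
  classical
  let f : Finset (Fin 3) → V := fun A =>
    if 0 ∈ A then (if 1 ∈ A then (if 2 ∈ A then t else s01) else (if 2 ∈ A then s02 else y0))
    else (if 1 ∈ A then (if 2 ∈ A then s12 else y1) else (if 2 ∈ A then y2 else x))
  have f0 : f ∅ = x := by simp [f]
  have f1 : f {0} = y0 := by simp [f]
  have f2 : f {1} = y1 := by simp [f]
  have f3 : f {2} = y2 := by simp [f]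
  have f4 : f {0, 1} = s01 := by simp [f]
  have f5 : f {0, 2} = s02 := by simp [f]
  have f6 : f {1, 2} = s12 := by simp [f]
  have f7 : f {0, 1, 2} = t := by simp [f]
  have sy : ∀ {u v : V}, G.Adj u v → G.Adj v u := fun h => h.symm
  have sn : ∀ {u v : V}, ¬ G.Adj u v → ¬ G.Adj v u := fun h h' => h h'.symm
  have hadj : ∀ A B : Finset (Fin 3), G.Adj (f A) (f B) ↔ (symmDiff A B).card = 1 := by
    intro A B
    rcases finset_fin3 A with rfl | rfl | rfl | rfl | rfl | rfl | rfl | rfl <;>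
    rcases finset_fin3 B with rfl | rfl | rfl | rfl | rfl | rfl | rfl | rfl <;>
    simp only [f0, f1, f2, f3, f4, f5, f6, f7] <;>
    first
    | exact iff_of_true (by assumption) (by decide)
    | exact iff_of_true (sy (by assumption)) (by decide)
    | exact iff_of_false (by assumption) (by decide)
    | exact iff_of_false (sn (by assumption)) (by decide)
    | exact iff_of_false (G.irrefl) (by decide)
  refine ⟨f, ?_, fun _ => trivial, hadj⟩
  intro A B h
  refine finset_fin3_sep A B fun C => ?_
  rw [← hadj, ← hadj, h]

lemma three_parents (hM : MedianGraph G) (hQ : CubeFree G) {x y0 y1 y2 o : V}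
    (h01 : y0 ≠ y1) (h02 : y0 ≠ y2) (h12 : y1 ≠ y2)
    (a0 : G.Adj x y0) (a1 : G.Adj x y1) (a2 : G.Adj x y2)
    (d0 : G.dist y0 o + 1 = G.dist x o) (d1 : G.dist y1 o + 1 = G.dist x o)
    (d2 : G.dist y2 o + 1 = G.dist x o) : False := by
  apply hQ
  obtain ⟨s01, b0, b1, e0, e1⟩ := quad hM a0 a1 h01 d0 d1
  obtain ⟨s02, c0, c2, e2, e3⟩ := quad hM a0 a2 h02 d0 d2
  obtain ⟨s12, g1, g2, e4, e5⟩ := quad hM a1 a2 h12 d1 d2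
  have nope : ∀ s, G.dist s o + 1 = G.dist y0 o → G.Adj s y0 → G.Adj s y1 → G.Adj s y2 → False := by
    intro s hs k0 k1 k2
    have := k23_free hM h01 h12 h02.symm a0 a1 a2 k0 k1 k2
    subst this
    omega
  have p1 : s01 ≠ s02 := by rintro rfl; exact nope s01 e0 b0 b1 c2
  have p2 : s02 ≠ s12 := by rintro rfl; exact nope s02 e2 c0 g1 c2
  have p3 : s01 ≠ s12 := by rintro rfl; exact nope s01 e0 b0 b1 g2
  have q1 : G.dist s01 s02 = 2 := dist_two hM b0.symm c0.symm p1
  have q2 : G.dist s02 s12 = 2 := dist_two hM c2.symm g2.symm p2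
  have q3 : G.dist s01 s12 = 2 := dist_two hM b1.symm g1.symm p3
  obtain ⟨t, ⟨h1, h2, h3⟩, -⟩ := hM.2 s01 s02 s12
  rw [mem_gInt] at h1 h2 h3
  rw [G.dist_comm (u := s12) (v := s01)] at h3
  rw [G.dist_comm (u := t) (v := s01)] at h3
  rw [G.dist_comm (u := t) (v := s02)] at h1
  rw [G.dist_comm (u := t) (v := s12)] at h2
  have t1 : G.Adj s01 t := SimpleGraph.dist_eq_one_iff_adj.1 (by omega)
  have t2 : G.Adj s02 t := SimpleGraph.dist_eq_one_iff_adj.1 (by omega)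
  have t3 : G.Adj s12 t := SimpleGraph.dist_eq_one_iff_adj.1 (by omega)
  -- equal distance to a common vertex forbids adjacency
  have par : ∀ {v u w : V}, G.dist v u = G.dist v w → ¬ G.Adj u w :=
    fun h h' => adj_dist_ne hM h' _ h
  have two : ∀ {u w : V}, G.dist u w = 2 → ¬ G.Adj u w := by
    intro u w h h'
    rw [SimpleGraph.dist_eq_one_iff_adj.2 h'] at h
    omega
  have parO : ∀ {u w : V}, G.dist u o = G.dist w o → ¬ G.Adj u w := by
    intro u w h
    apply par (v := o)
    rw [G.dist_comm, h, G.dist_comm]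
  have parO2 : ∀ {u w : V}, G.dist u o + 2 = G.dist w o → ¬ G.Adj w u := by
    intro u w h h'
    have := adj_dist_cases hM h' o
    rw [G.dist_comm (u := o), G.dist_comm (u := o)] at this
    omega
  have nxt : ¬ G.Adj x t := by
    intro hxt
    have := k23_free hM (s := x) (t := s01) (x := y0) (y := y1) (z := t) h01
      (by rintro rfl; exact nope s12 (by omega) (by
            exfalso
            exact nope s02 e2 c0 t2 c2) g1 g2)
      (by rintro rfl; exact nope s12 (by omega) t3 g1 g2) a0 a1 hxt b0 b1 t1
    subst this
    omega
  have dt := adj_dist_cases hM t1 o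
  simp only [G.dist_comm (u := o)] at dt
  have dt1 : ∀ y, G.dist y o = G.dist y0 o → ¬ G.Adj y t := by
    intro y hy hadj
    have := adj_dist_cases hM hadj o
    simp only [G.dist_comm (u := o)] at this
    omega
  exact cube_of x y0 y1 y2 s01 s02 s12 t a0 a1 a2 b0.symm c0.symm b1.symm g1.symm c2.symm g2.symm
    t1 t2 t3 (parO2 (by omega)) (parO2 (by omega)) (parO2 (by omega)) nxt
    (parO (by omega)) (parO (by omega)) (parO (by omega))
    (fun h => nope s12 (by omega) h.symm g1 g2)
    (fun h => nope s02 (by omega) c0 h.symm c2)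
    (fun h => nope s01 (by omega) b0 b1 h.symm)
    (dt1 _ (by omega)) (dt1 _ (by omega)) (dt1 _ (by omega))
    (two q1) (two q3) (two q2)

/-- at most two parents towards `o` -/
lemma parents_card [Fintype V] (hM : MedianGraph G) (hQ : CubeFree G) (x o : V) (s : Finset V)
    (hs : ∀ y ∈ s, G.Adj x y ∧ G.dist y o + 1 = G.dist x o) : s.card ≤ 2 := by
  by_contra hcard
  obtain ⟨a, b, c, ha, hb, hc, h1, h2, h3⟩ := Finset.two_lt_card_iff.1 (not_le.1 hcard)
  exact three_parents hM hQ h1 h2 h3 (hs a ha).1 (hs b hb).1 (hs c hc).1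
    (hs a ha).2 (hs b hb).2 (hs c hc).2

end CubeLemma

section Walls

variable {V : Type*} {G : SimpleGraph V}

lemma int_left (u v : V) : u ∈ gInterval G u v := by simp [gInterval]
lemma int_right (u v : V) : v ∈ gInterval G u v := by simp [gInterval]
lemma int_symm {u v w : V} : w ∈ gInterval G u v → w ∈ gInterval G v u := by
  intro h
  rw [mem_gInt] at *
  rw [G.dist_comm (u := v) (v := w), G.dist_comm (u := w) (v := u), G.dist_comm (u := v) (v := u)]
  omega

lemma Wc_convex (hM : MedianGraph G) {a z : V} (h : G.Adj a z) {x y w : V}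
    (hx : x ∉ halfspaceW G a z) (hy : y ∉ halfspaceW G a z) (hw : w ∈ gInterval G x y) :
    w ∉ halfspaceW G a z := by
  rw [not_mem_W hM h] at *
  exact W_convex hM h.symm x hx y hy hw

/-- An edge crossing the wall of `b z` induces the same halfspaces. -/
lemma wall_eq (hM : MedianGraph G) {b z q a : V} (h : G.Adj b z) (hqa : G.Adj a q)
    (hq : q ∈ halfspaceW G b z) (ha : a ∉ halfspaceW G b z) (x : V) :
    (x ∈ halfspaceW G b z → G.dist x a = G.dist x q + 1) ∧
    (x ∉ halfspaceW G b z → G.dist x q = G.dist x a + 1) := by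
  have c := adj_dist_cases hM hqa x
  have h1 := SimpleGraph.dist_eq_one_iff_adj.2 hqa
  have h2 := SimpleGraph.dist_eq_one_iff_adj.2 hqa.symm
  constructor
  · intro hx
    by_contra hne
    refine ha (W_convex hM h x hx q hq ?_)
    rw [mem_gInt]; omega
  · intro hx
    by_contra hne
    refine Wc_convex hM h hx ha ?_ hq
    rw [mem_gInt]; omega

lemma exit_port (hM : MedianGraph G) {a z u : V} (h : G.Adj a z) (hu : u ∈ halfspaceW G a z) :
    ∃ w, G.Adj u w ∧ ∀ v, v ∉ halfspaceW G a z → G.dist w v + 1 = G.dist u v := by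
  have hz : z ∈ halfspaceW G z a := by
    rw [mem_W, SimpleGraph.dist_self]; exact hM.1.pos_dist_of_ne h.ne'
  obtain ⟨g, hg, hgate⟩ := gate_exists hM (W_convex hM h.symm) ⟨z, hz⟩ u
  have hug : u ≠ g := by
    rintro rfl
    exact (not_mem_W hM h).2 hg hu
  obtain ⟨w, hw1, hw2⟩ := step_exists hM.1 hug
  refine ⟨w, hw1, fun v hv => ?_⟩
  have := hgate v ((not_mem_W hM h).1 hv)
  have t1 := hM.1.dist_triangle (u := w) (v := g) (w := v)
  have t2 := hM.1.dist_triangle (u := u) (v := w) (w := v)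
  have := SimpleGraph.dist_eq_one_iff_adj.2 hw1
  omega

lemma gate_out (hM : MedianGraph G) {b z v : V} (h : G.Adj b z) (hv : v ∈ halfspaceW G b z) :
    ∃ g g', G.Adj g g' ∧ g' ∈ halfspaceW G b z ∧ g ∉ halfspaceW G b z ∧
      (∀ u, u ∉ halfspaceW G b z → G.dist u v = G.dist u g + G.dist g v) ∧
      G.dist g' v + 1 = G.dist g v := by
  have hz : z ∈ halfspaceW G z b := by
    rw [mem_W, SimpleGraph.dist_self]; exact hM.1.pos_dist_of_ne h.ne'
  obtain ⟨g, hg, hgate⟩ := gate_exists hM (W_convex hM h.symm) ⟨z, hz⟩ v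
  have hgn := (not_mem_W hM h).2 hg
  have hug : g ≠ v := by
    rintro rfl
    exact hgn hv
  obtain ⟨w, hw1, hw2⟩ := step_exists hM.1 hug
  refine ⟨g, w, hw1, ?_, hgn, ?_, hw2⟩
  · by_contra hw
    have := hgate w ((not_mem_W hM h).1 hw)
    rw [G.dist_comm (u := v) (v := w), G.dist_comm (u := v) (v := g)] at this
    omega
  · intro u hu
    have := hgate u ((not_mem_W hM h).1 hu)
    rw [G.dist_comm (u := v) (v := u), G.dist_comm (u := v) (v := g),
      G.dist_comm (u := g) (v := u)] at this
    omega

lemma test_vertex (hM : MedianGraph G) {a u P : V} (h : G.Adj u P)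
    (hP : G.dist P a + 1 = G.dist u a) :
    ∃ r, ∀ g, g ∈ halfspaceW G u P ↔ r ∈ gInterval G a g := by
  have hu : u ∈ halfspaceW G u P := by
    rw [mem_W, SimpleGraph.dist_self]; exact hM.1.pos_dist_of_ne h.ne
  have ha : a ∉ halfspaceW G u P := by
    rw [mem_W, G.dist_comm (u := a), G.dist_comm (u := a)]; omega
  obtain ⟨r, hr, hgate⟩ := gate_exists hM (W_convex hM h) ⟨u, hu⟩ a
  refine ⟨r, fun g => ⟨fun hg => (hgate g hg).symm, fun hg => ?_⟩⟩
  by_contra hn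
  exact Wc_convex hM h ha hn hg hr

/-- The total boundary tree of the panel of `a`. -/
def bTree (G : SimpleGraph V) (z a : V) : Set V :=
  {t | t ∈ halfspaceW G a z ∧ ∃ b, G.Adj b z ∧ t ∉ halfspaceW G b z ∧
    ∃ t', t' ∈ halfspaceW G b z ∧ t' ∈ halfspaceW G a z ∧ G.Adj t t'}

lemma bTree_aux (hM : MedianGraph G) {z a b t t' w : V} (haz : G.Adj a z) (hbz : G.Adj b z)
    (hta : t ∈ halfspaceW G a z) (htb : t ∉ halfspaceW G b z) (htb' : t' ∈ halfspaceW G b z)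
    (hta' : t' ∈ halfspaceW G a z) (htt : G.Adj t t') (hw : w ∈ gInterval G a t) :
    a ∉ halfspaceW G b z ∧ w ∈ halfspaceW G a z ∧ w ∉ halfspaceW G b z ∧
    ∃ w', w' ∈ halfspaceW G b z ∧ w' ∈ halfspaceW G a z ∧ G.Adj w w' := by
  have hab : a ≠ b := by rintro rfl; exact htb hta
  have dab : G.dist a b = 2 := dist_two hM haz.symm hbz.symm hab
  have daz : G.dist a z = 1 := SimpleGraph.dist_eq_one_iff_adj.2 haz
  have haW : a ∈ halfspaceW G a z := by rw [mem_W, SimpleGraph.dist_self]; omega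
  have haB : a ∉ halfspaceW G b z := by rw [mem_W]; omega
  have hwA : w ∈ halfspaceW G a z := W_convex hM haz a haW t hta hw
  have hwB : w ∉ halfspaceW G b z := Wc_convex hM hbz haB htb hw
  refine ⟨haB, hwA, hwB, ?_⟩
  -- the vertex q
  have ca := adj_dist_cases hM haz t'
  have cb := adj_dist_cases hM hbz t'
  rw [mem_W] at htb' hta'
  obtain ⟨q, qa, qb, dq1, dq2⟩ := quad hM haz.symm hbz.symm hab (o := t')
    (by rw [G.dist_comm, G.dist_comm (u := z)]; omega)
    (by rw [G.dist_comm, G.dist_comm (u := z)]; omega)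
  rw [← mem_W] at htb' hta'
  have hqB : q ∈ halfspaceW G b z := by
    refine W_convex hM hbz t' htb' b ?_ ?_
    · rw [mem_W, SimpleGraph.dist_self]; exact hM.1.pos_dist_of_ne hbz.ne
    · rw [mem_gInt, G.dist_comm (u := t'), G.dist_comm (u := t'),
        SimpleGraph.dist_eq_one_iff_adj.2 qb]
      omega
  have hqA : q ∈ halfspaceW G a z := by
    refine W_convex hM haz t' hta' a haW ?_
    rw [mem_gInt, G.dist_comm (u := t'), G.dist_comm (u := t'),
        SimpleGraph.dist_eq_one_iff_adj.2 qa]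
    omega
  obtain ⟨m, ⟨h1, h2, h3⟩, -⟩ := hM.2 w q t'
  have hmB := W_convex hM hbz q hqB t' htb' h2
  have hmA := W_convex hM haz q hqA t' hta' h2
  refine ⟨m, hmB, hmA, SimpleGraph.dist_eq_one_iff_adj.1 ?_⟩
  have w1 := (wall_eq hM hbz qa.symm hqB haB w).2 hwB
  have w2 := (wall_eq hM hbz htt htb' htb w).2 hwB
  have w3 := (wall_eq hM hbz qa.symm hqB haB t').1 htb'
  have w4 := (wall_eq hM hbz htt htb' htb a).2 haB
  rw [mem_gInt] at *
  rw [G.dist_comm (u := t') (v := m), G.dist_comm (u := m) (v := w), G.dist_comm (u := t') (v := w)] at h3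
  rw [G.dist_comm (u := w) (v := a)] at w1
  rw [G.dist_comm (u := t') (v := a), G.dist_comm (u := t') (v := q)] at w3
  rw [G.dist_comm (u := m) (v := q)] at h1
  omega

lemma bTree_down (hM : MedianGraph G) {z a t w : V} (haz : G.Adj a z) (ht : t ∈ bTree G z a)
    (hw : w ∈ gInterval G a t) : w ∈ bTree G z a := by
  obtain ⟨hta, b, hbz, htb, t', h1, h2, h3⟩ := ht
  obtain ⟨-, k1, k2, w', k3, k4, k5⟩ := bTree_aux hM haz hbz hta htb h1 h2 h3 hw
  exact ⟨k1, b, hbz, k2, w', k3, k4, k5⟩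

lemma bTree_parent (hM : MedianGraph G) (hQ : CubeFree G) {z a t x y : V} (haz : G.Adj a z)
    (ht : t ∈ bTree G z a) (hx : G.Adj t x) (hy : G.Adj t y)
    (dx : G.dist x a + 1 = G.dist t a) (dy : G.dist y a + 1 = G.dist t a) : x = y := by
  obtain ⟨hta, b, hbz, htb, t', h1, h2, h3⟩ := ht
  have hI : ∀ x, G.Adj t x → G.dist x a + 1 = G.dist t a → x ∈ gInterval G a t := by
    intro x hx dx
    rw [mem_gInt, SimpleGraph.dist_eq_one_iff_adj.2 hx.symm, G.dist_comm, dx, G.dist_comm]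
  obtain ⟨haB, k1, k2, x', k3, k4, k5⟩ := bTree_aux hM haz hbz hta htb h1 h2 h3 (hI x hx dx)
  obtain ⟨-, l1, l2, y', l3, l4, l5⟩ := bTree_aux hM haz hbz hta htb h1 h2 h3 (hI y hy dy)
  by_contra hne
  have lift : ∀ x x', G.Adj t x → G.dist x a + 1 = G.dist t a → x ∉ halfspaceW G b z →
      x' ∈ halfspaceW G b z → G.Adj x x' → G.Adj t' x' ∧ G.dist x' a + 1 = G.dist t' a := by
    intro x x' hx dx hxB hxB' hadj
    have w1 := (wall_eq hM hbz hadj hxB' hxB t).2 htb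
    have w2 := (wall_eq hM hbz h3 h1 htb x').1 hxB'
    have w3 := (wall_eq hM hbz hadj hxB' hxB a).2 haB
    have w4 := (wall_eq hM hbz h3 h1 htb a).2 haB
    have := SimpleGraph.dist_eq_one_iff_adj.2 hx
    rw [G.dist_comm (u := x')] at w2
    rw [G.dist_comm, G.dist_comm (u := a)] at w3 w4
    refine ⟨SimpleGraph.dist_eq_one_iff_adj.1 ?_, by omega⟩
    rw [G.dist_comm]
    omega
  obtain ⟨m1, m2⟩ := lift x x' hx dx k2 k3 k5
  obtain ⟨m3, m4⟩ := lift y y' hy dy l2 l3 l5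
  have w4 := (wall_eq hM hbz h3 h1 htb a).2 haB
  have hxy : x' ≠ y' := by
    rintro rfl
    have w1 := (wall_eq hM hbz k5 k3 k2 y).2 l2
    rw [SimpleGraph.dist_eq_one_iff_adj.2 l5] at w1
    have : G.dist y x = 0 := by omega
    exact hne (hM.1.dist_eq_zero_iff.1 this).symm
  refine three_parents hM hQ (x := t') (y0 := t) (y1 := x') (y2 := y') (o := a) ?_ ?_ hxy h3.symm
    m1 m3 ?_ m2 m4
  · rintro rfl; exact htb k3
  · rintro rfl; exact htb l3
  · rw [G.dist_comm (u := t), G.dist_comm (u := t')]; omega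

lemma bTree_chain (hM : MedianGraph G) (hQ : CubeFree G) {z a : V} (haz : G.Adj a z) :
    ∀ t ∈ bTree G z a, ∀ x ∈ gInterval G a t, ∀ y ∈ gInterval G a t,
      x ∈ gInterval G a y ∨ y ∈ gInterval G a x := by
  have main : ∀ k, ∀ t ∈ bTree G z a, G.dist a t = k → ∀ x ∈ gInterval G a t,
      ∀ y ∈ gInterval G a t, x ∈ gInterval G a y ∨ y ∈ gInterval G a x := by
    intro k
    induction k with
    | zero =>
      intro t ht hk x hx y hy
      left
      rw [mem_gInt] at *
      have e1 : G.dist a x = 0 := by omega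
      rw [hM.1.dist_eq_zero_iff] at e1
      subst e1
      simp
    | succ k ih =>
      intro t ht hk x hx y hy
      by_cases hxt : t = x
      · subst hxt; exact Or.inr hy
      by_cases hyt : t = y
      · subst hyt; exact Or.inl hx
      have par : ∀ x ∈ gInterval G a t, t ≠ x → ∃ w, G.Adj t w ∧ G.dist w a + 1 = G.dist t a ∧
          x ∈ gInterval G a w := by
        intro x hx hne
        obtain ⟨w, h1, h2⟩ := step_exists hM.1 hne
        rw [mem_gInt] at hx
        have t1 := hM.1.dist_triangle (u := w) (v := x) (w := a)
        have t2 := hM.1.dist_triangle (u := t) (v := w) (w := a)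
        have := SimpleGraph.dist_eq_one_iff_adj.2 h1
        rw [G.dist_comm (u := a) (v := x), G.dist_comm (u := x) (v := t),
          G.dist_comm (u := a) (v := t)] at hx
        refine ⟨w, h1, by omega, ?_⟩
        rw [mem_gInt, G.dist_comm (u := a) (v := x), G.dist_comm (u := x) (v := w),
          G.dist_comm (u := a) (v := w)]
        omega
      obtain ⟨w, h1, h2, h3⟩ := par x hx hxt
      obtain ⟨w', h1', h2', h3'⟩ := par y hy hyt
      have := bTree_parent hM hQ haz ht h1 h1' h2 h2'
      subst this
      have e : G.dist a w = k := by
        have e1 := G.dist_comm (u := a) (v := w)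
        have e2 := G.dist_comm (u := a) (v := t)
        omega
      refine ih w (bTree_down hM haz ht ?_) e x h3 y h3'
      rw [mem_gInt, SimpleGraph.dist_eq_one_iff_adj.2 h1.symm]
      omega
  intro t ht
  exact main _ t ht rfl

end Walls

section TreeLabels

variable {V : Type*} {G : SimpleGraph V}

/-- `q` is the port at `u` of a neighbor one step closer to `v`. -/
def GoodPort (G : SimpleGraph V) (p : V → V → ℕ) (u v : V) (q : ℕ) : Prop :=
  ∃ w, G.Adj u w ∧ G.dist w v + 1 = G.dist u v ∧ q = p u w

/-- Ancestor test on tree labels. -/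
def TLTest (r : ℕ × ℕ) (l : List (ℕ × ℕ × ℕ)) : Prop :=
  ∃ x ∈ l, x.1 = r.1 ∧ r.2 ≤ x.2.1

lemma dist_le_card [Fintype V] (hc : G.Connected) (u v : V) : G.dist u v ≤ Fintype.card V := by
  classical
  obtain ⟨q, hq, hl⟩ := hc.exists_path_of_dist u v
  rw [← hl]
  exact hq.length_lt.le

lemma int_trans (hc : G.Connected) {a x y z : V} (h1 : x ∈ gInterval G a y)
    (h2 : y ∈ gInterval G a z) : x ∈ gInterval G a z := by
  rw [mem_gInt] at *
  have t1 := hc.dist_triangle (u := x) (v := y) (w := z)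
  have t2 := hc.dist_triangle (u := a) (v := x) (w := z)
  omega

lemma int_eq (hc : G.Connected) {a x y : V} (h1 : x ∈ gInterval G a y)
    (h2 : G.dist a y ≤ G.dist a x) : x = y := by
  rw [mem_gInt] at h1
  have : G.dist x y = 0 := by omega
  exact hc.dist_eq_zero_iff.1 this

lemma tree_labels [Fintype V] (hc : G.Connected) (p : V → V → ℕ)
    (hp : ∀ u w, G.Adj u w → p u w ≤ Fintype.card V) (a : V) (T : Set V)
    (hdown : ∀ t ∈ T, ∀ x ∈ gInterval G a t, x ∈ T)
    (hchain : ∀ t ∈ T, ∀ x ∈ gInterval G a t, ∀ y ∈ gInterval G a t,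
      x ∈ gInterval G a y ∨ y ∈ gInterval G a x) :
    ∃ (loc : V → ℕ × ℕ) (hv : V → ℕ) (TL : V → ℕ → List (ℕ × ℕ × ℕ)),
      (∀ u, (loc u).1 ≤ Fintype.card V ∧ (loc u).2 ≤ Fintype.card V) ∧
      (∀ u, hv u ≤ Fintype.card V) ∧
      (∀ g q, q ≤ Fintype.card V → (TL g q).length ≤ Nat.log 2 (Fintype.card V) + 1 ∧
        ∀ x ∈ TL g q, x.1 ≤ Fintype.card V ∧ x.2.1 ≤ Fintype.card V ∧ x.2.2 ≤ Fintype.card V) ∧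
      (∀ g ∈ T, ∀ q r, TLTest (loc r) (TL g q) ↔ r ∈ gInterval G a g) ∧
      (∀ g ∈ T, ∀ q, ∀ u ∈ gInterval G a g, ∀ x ∈ TL g q, x.1 = (loc u).1 →
        ((loc u).2 < x.2.1 → GoodPort G p u g (hv u)) ∧
        ((loc u).2 = x.2.1 → (u = g → x.2.2 = q) ∧ (u ≠ g → GoodPort G p u g x.2.2))) := by
  classical
  let n := Fintype.card V
  let idn : V → ℕ := fun v => (Fintype.equivFin V v : ℕ) + 1
  have idn_le : ∀ v, idn v ≤ n := fun v => (Fintype.equivFin V v).2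
  have idn_inj : ∀ u v, idn u = idn v → u = v := by
    intro u v h
    apply (Fintype.equivFin V).injective
    apply Fin.ext
    simpa [idn] using h
  let up : V → Finset V := fun t => Finset.univ.filter fun g => g ∈ T ∧ t ∈ gInterval G a g
  have mem_up : ∀ t g, g ∈ up t ↔ g ∈ T ∧ t ∈ gInterval G a g := by intro t g; simp [up]
  let lev : V → ℕ := fun t => Nat.log 2 (up t).card
  have up_mono : ∀ x y, x ∈ gInterval G a y → up y ⊆ up x := by
    intro x y h g hg
    rw [mem_up] at *
    exact ⟨hg.1, int_trans hc h hg.2⟩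
  have lev_mono : ∀ x y, x ∈ gInterval G a y → lev y ≤ lev x := fun x y h =>
    Nat.log_mono_right (Finset.card_le_card (up_mono x y h))
  have up_ne : ∀ t ∈ T, (up t).card ≠ 0 := by
    intro t ht
    rw [Finset.card_ne_zero]
    exact ⟨t, (mem_up t t).2 ⟨ht, int_right a t⟩⟩
  have lev_le : ∀ t, lev t ≤ Nat.log 2 n := fun t =>
    Nat.log_mono_right (Finset.card_le_univ _)
  have key : ∀ h ∈ T, ∀ x ∈ T, ∀ y ∈ T, h ∈ gInterval G a x → h ∈ gInterval G a y →
      lev x = lev h → lev y = lev h → x ∈ gInterval G a y ∨ y ∈ gInterval G a x := by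
    intro h hT x hx y hy hhx hhy lx ly
    by_contra hcon
    have hdisj : Disjoint (up x) (up y) := by
      rw [Finset.disjoint_left]
      intro g hg1 hg2
      rw [mem_up] at hg1 hg2
      exact hcon (hchain g hg1.1 x hg1.2 y hg2.2)
    have h1 : (up x ∪ up y).card ≤ (up h).card :=
      Finset.card_le_card (Finset.union_subset (up_mono _ _ hhx) (up_mono _ _ hhy))
    rw [Finset.card_union_of_disjoint hdisj] at h1
    have h2 : 2 ^ lev x ≤ (up x).card := Nat.pow_log_le_self 2 (up_ne x hx)
    have h3 : 2 ^ lev y ≤ (up y).card := Nat.pow_log_le_self 2 (up_ne y hy)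
    have h4 : (up h).card < 2 ^ (lev h + 1) := Nat.lt_pow_succ_log_self (by norm_num) _
    rw [lx] at h2
    rw [ly] at h3
    rw [pow_succ] at h4
    omega
  -- tops of the level paths
  have top_ex : ∀ t, ∃ s, s ∈ gInterval G a t ∧ lev s = lev t ∧
      ∀ s', s' ∈ gInterval G a t → lev s' = lev t → G.dist a s ≤ G.dist a s' := by
    intro t
    obtain ⟨s, hs, hmin⟩ := Finset.exists_min_image
      (Finset.univ.filter fun s => s ∈ gInterval G a t ∧ lev s = lev t) (fun s => G.dist a s)
      ⟨t, by simp [int_right]⟩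
    simp only [Finset.mem_filter, Finset.mem_univ, true_and] at hs hmin
    exact ⟨s, hs.1, hs.2, fun s' h1 h2 => hmin s' ⟨h1, h2⟩⟩
  choose top top1 top2 top3 using top_ex
  have top_le : ∀ t ∈ T, ∀ s ∈ gInterval G a t, lev s = lev t → top t ∈ gInterval G a s := by
    intro t ht s hs hl
    rcases hchain t ht (top t) (top1 t) s hs with h | h
    · exact h
    · have := int_eq hc h (top3 t s hs hl)
      rw [this]; exact int_right _ _
  -- deepest vertices
  let E : V → Finset V := fun g => Finset.univ.filter fun e => e ∈ gInterval G a g ∧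
    ∀ s, s ∈ gInterval G a g → lev s = lev e → G.dist a s ≤ G.dist a e
  have mem_E : ∀ g e, e ∈ E g ↔ e ∈ gInterval G a g ∧
    ∀ s, s ∈ gInterval G a g → lev s = lev e → G.dist a s ≤ G.dist a e := by
    intro g e; simp [E]
  let nxt : V → V → ℕ := fun e g => if h : ∃ q, GoodPort G p e g q then h.choose else 0
  have nxt_spec : ∀ e g, e ≠ g → GoodPort G p e g (nxt e g) := by
    intro e g h
    obtain ⟨w, h1, h2⟩ := step_exists hc h
    have hex : ∃ q, GoodPort G p e g q := ⟨_, w, h1, h2, rfl⟩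
    simp only [nxt, dif_pos hex]
    exact hex.choose_spec
  have good_le : ∀ u v q, GoodPort G p u v q → q ≤ n := by
    rintro u v q ⟨w, h1, -, rfl⟩
    exact hp u w h1
  have nxt_le : ∀ e g, nxt e g ≤ n := by
    intro e g
    by_cases hex : ∃ q, GoodPort G p e g q
    · simp only [nxt, dif_pos hex]
      exact good_le _ _ _ hex.choose_spec
    · simp only [nxt, dif_neg hex]; exact Nat.zero_le _
  let HV : V → V → Prop := fun u w => G.Adj u w ∧ w ∈ T ∧ lev w = lev u ∧ u ∈ gInterval G a w
  let hv : V → ℕ := fun u => if h : ∃ w, HV u w then p u h.choose else 0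
  let loc : V → ℕ × ℕ := fun r => if r ∈ T then (idn (top r), G.dist a r) else (0, 0)
  let TL : V → ℕ → List (ℕ × ℕ × ℕ) := fun g q =>
    if g ∈ T then (E g).toList.map fun e =>
      (idn (top e), G.dist a e, if e = g then q else nxt e g) else []
  have mem_TL : ∀ g ∈ T, ∀ q x, x ∈ TL g q ↔ ∃ e ∈ E g,
      (idn (top e), G.dist a e, if e = g then q else nxt e g) = x := by
    intro g hg q x
    simp [TL, hg]
  have loc_T : ∀ r ∈ T, loc r = (idn (top r), G.dist a r) := by
    intro r hr; simp [loc, hr]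
  -- common argument
  have comm : ∀ g ∈ T, ∀ e ∈ E g, ∀ r ∈ T, idn (top e) = idn (top r) → G.dist a r ≤ G.dist a e →
      r ∈ gInterval G a e ∧ lev r = lev e := by
    intro g hg e he r hr h1 h2
    have heT := hdown g hg e ((mem_E g e).1 he).1
    have ht := idn_inj _ _ h1
    have e1 : lev e = lev (top r) := by rw [← ht, top2]
    have e2 : lev r = lev (top r) := (top2 r).symm
    refine ⟨?_, e2.trans e1.symm⟩
    rcases key (top r) (hdown r hr _ (top1 r)) r hr e heT (top1 r) (ht ▸ top1 e) e2 e1 with h | h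
    · exact h
    · have := int_eq hc h h2
      rw [this]; exact int_right _ _
  refine ⟨loc, hv, TL, ?_, ?_, ?_, ?_, ?_⟩
  · intro u
    by_cases hu : u ∈ T
    · rw [loc_T u hu]; exact ⟨idn_le _, dist_le_card hc _ _⟩
    · simp [loc, hu]
  · intro u
    by_cases hex : ∃ w, HV u w
    · simp only [hv, dif_pos hex]
      exact hp _ _ hex.choose_spec.1
    · simp only [hv, dif_neg hex]; exact Nat.zero_le _
  · intro g q hq
    by_cases hg : g ∈ T
    · constructor
      · simp only [TL, if_pos hg, List.length_map, Finset.length_toList]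
        rw [← Finset.card_range (Nat.log 2 (Fintype.card V) + 1)]
        apply Finset.card_le_card_of_injOn lev
        · intro e he
          simp only [Finset.coe_range, Set.mem_Iio]
          exact Nat.lt_succ_of_le (lev_le e)
        · intro e he e' he' hl
          have h1 := (mem_E g e).1 he
          have h2 := (mem_E g e').1 he'
          have h3 := h1.2 e' h2.1 hl.symm
          have h4 := h2.2 e h1.1 hl
          rcases hchain g hg e h1.1 e' h2.1 with h | h
          · exact int_eq hc h h3
          · exact (int_eq hc h h4).symm
      · intro x hx
        obtain ⟨e, he, rfl⟩ := (mem_TL g hg q x).1 hx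
        refine ⟨idn_le _, dist_le_card hc _ _, ?_⟩
        dsimp only
        split_ifs
        · exact hq
        · exact nxt_le _ _
    · simp [TL, hg]
  · intro g hg q r
    constructor
    · rintro ⟨x, hx, h1, h2⟩
      obtain ⟨e, he, rfl⟩ := (mem_TL g hg q x).1 hx
      by_cases hr : r ∈ T
      · rw [loc_T r hr] at h1 h2
        exact int_trans hc (comm g hg e he r hr h1 h2).1 ((mem_E g e).1 he).1
      · simp [loc, hr, idn] at h1
    · intro hr
      have hrT := hdown g hg r hr
      obtain ⟨e, he, hmax⟩ := Finset.exists_max_image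
        (Finset.univ.filter fun s => s ∈ gInterval G a g ∧ lev s = lev r) (fun s => G.dist a s)
        ⟨r, by simp [hr]⟩
      simp only [Finset.mem_filter, Finset.mem_univ, true_and] at he hmax
      have heT := hdown g hg e he.1
      have heE : e ∈ E g := by
        rw [mem_E]
        exact ⟨he.1, fun s h1 h2 => hmax s ⟨h1, h2.trans he.2⟩⟩
      have hre : r ∈ gInterval G a e := by
        rcases hchain g hg r hr e he.1 with h | h
        · exact h
        · have := int_eq hc h (hmax r ⟨hr, rfl⟩)
          rw [this]; exact int_right _ _
      refine ⟨_, (mem_TL g hg q _).2 ⟨e, heE, rfl⟩, ?_, ?_⟩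
      · rw [loc_T r hrT]
        dsimp only
        congr 1
        have h1 : top e ∈ gInterval G a (top r) :=
          top_le e heT (top r) (int_trans hc (top1 r) hre) ((top2 r).trans he.2.symm)
        have h2 : top r ∈ gInterval G a (top e) :=
          top_le r hrT (top e) (int_trans hc h1 (top1 r)) ((top2 e).trans he.2)
        apply int_eq hc h1
        rw [mem_gInt] at h2
        omega
      · rw [loc_T r hrT]
        exact hmax r ⟨hr, rfl⟩
  · intro g hg q u hu x hx h1
    have huT := hdown g hg u hu
    obtain ⟨e, he, rfl⟩ := (mem_TL g hg q x).1 hx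
    have heg := ((mem_E g e).1 he).1
    have heT := hdown g hg e heg
    rw [loc_T u huT] at *
    dsimp only at *
    constructor
    · intro hlt
      obtain ⟨hue, hl⟩ := comm g hg e he u huT h1 hlt.le
      have hne : u ≠ e := by rintro rfl; omega
      obtain ⟨w, w1, w2⟩ := step_exists hc hne
      have w3 := SimpleGraph.dist_eq_one_iff_adj.2 w1
      have t1 := hc.dist_triangle (u := a) (v := u) (w := w)
      have t2 := hc.dist_triangle (u := a) (v := w) (w := e)
      have hue' := hue
      rw [mem_gInt] at hue'
      have hwe : w ∈ gInterval G a e := by rw [mem_gInt]; omega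
      have huw : u ∈ gInterval G a w := by rw [mem_gInt]; omega
      have l1 := lev_mono _ _ hwe
      have l2 := lev_mono _ _ huw
      have hex : ∃ w, HV u w := ⟨w, w1, hdown e heT w hwe, by omega, huw⟩
      simp only [hv, dif_pos hex]
      obtain ⟨c1, c2, c3, c4⟩ := hex.choose_spec
      set w' := hex.choose with hw'
      have hd : G.dist a w' = G.dist a u + 1 := by
        have := SimpleGraph.dist_eq_one_iff_adj.2 c1
        rw [mem_gInt] at c4; omega
      have hw'e : w' ∈ gInterval G a e := by
        rcases key u huT w' c2 e heT c4 hue c3 hl.symm with h | h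
        · exact h
        · have := int_eq hc h (by omega)
          rw [this]; exact int_right _ _
      refine ⟨w', c1, ?_, rfl⟩
      have hw'g := int_trans hc hw'e heg
      rw [mem_gInt] at hw'g hu
      omega
    · intro heq
      obtain ⟨hue, hl⟩ := comm g hg e he u huT h1 heq.le
      have := int_eq hc hue heq.ge
      subst this
      constructor
      · intro h; rw [if_pos h]
      · intro h; rw [if_neg h]; exact nxt_spec _ _ h

end TreeLabels

section Encoding

/-- Prefix-free (self-delimiting) encodings. -/
def PF {α : Type} (e : α → List Bool) : Prop :=
  ∀ a b s t, e a ++ s = e b ++ t → a = b ∧ s = t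

def encProd {α β : Type} (e : α → List Bool) (f : β → List Bool) : α × β → List Bool :=
  fun x => e x.1 ++ f x.2

def encList {α : Type} (e : α → List Bool) : List α → List Bool
  | [] => [false]
  | x :: l => true :: (e x ++ encList e l)

def encNat (n : ℕ) : List Bool := encList (fun b => [b]) n.bits

lemma PF.prod {α β : Type} {e : α → List Bool} {f : β → List Bool} (he : PF e) (hf : PF f) :
    PF (encProd e f) := by
  rintro ⟨a, b⟩ ⟨a', b'⟩ s t h
  simp only [encProd, List.append_assoc] at h
  obtain ⟨rfl, h1⟩ := he _ _ _ _ h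
  obtain ⟨rfl, h2⟩ := hf _ _ _ _ h1
  exact ⟨rfl, h2⟩

lemma PF.list {α : Type} {e : α → List Bool} (he : PF e) : PF (encList e) := by
  intro l
  induction l with
  | nil =>
    intro l' s t h
    cases l' with
    | nil => simpa [encList] using h
    | cons y l' => simp [encList] at h
  | cons x l ih =>
    intro l' s t h
    cases l' with
    | nil => simp [encList] at h
    | cons y l' =>
      simp only [encList, List.cons_append, List.cons.injEq, true_and, List.append_assoc] at h
      obtain ⟨rfl, h1⟩ := he _ _ _ _ h
      obtain ⟨rfl, h2⟩ := ih _ _ _ h1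
      exact ⟨rfl, h2⟩

lemma bits_inj {m n : ℕ} (h : m.bits = n.bits) : m = n := by
  have : ∀ k : ℕ, k = Nat.ofDigits 2 (k.bits.map fun b => cond b 1 0) := by
    intro k
    rw [← Nat.digits_two_eq_bits, Nat.ofDigits_digits]
  rw [this m, this n, h]

lemma PF.nat : PF encNat := by
  intro a b s t h
  have hb : PF (fun b : Bool => [b]) := by
    intro a b s t h
    simpa using h
  obtain ⟨h1, h2⟩ := hb.list _ _ _ _ h
  exact ⟨bits_inj h1, h2⟩

lemma PF.inj {α : Type} {e : α → List Bool} (he : PF e) : Function.Injective e := by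
  intro a b h
  exact (he a b [] [] (by rw [h])).1

lemma encList_length {α : Type} (e : α → List Bool) (M : ℕ) (l : List α)
    (h : ∀ x ∈ l, (e x).length ≤ M) : (encList e l).length ≤ l.length * (M + 1) + 1 := by
  induction l with
  | nil => simp [encList]
  | cons x l ih =>
    have h1 := h x (by simp)
    have h2 := ih fun y hy => h y (by simp [hy])
    simp only [encList, List.length_cons, List.length_append]
    rw [Nat.succ_mul]
    omega

lemma encNat_length {n N : ℕ} (hN : 2 ≤ N) (h : n ≤ N) :
    (encNat n).length ≤ 5 * Nat.log 2 N := by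
  have h1 := encList_length (fun b : Bool => [b]) 1 n.bits (by simp)
  rw [Nat.size_eq_bits_len] at h1
  have h2 : n.size ≤ Nat.log 2 N + 1 := by
    rw [Nat.size_le]
    exact lt_of_le_of_lt h (Nat.lt_pow_succ_log_self (by norm_num) _)
  have h3 : 1 ≤ Nat.log 2 N := Nat.log_pos (by norm_num) hN
  unfold encNat
  omega

abbrev Ent1 := ℕ × ℕ × ℕ × (ℕ × ℕ) × ℕ × List (ℕ × (ℕ × ℕ))
abbrev Ent2 := ℕ × ℕ × List (ℕ × ℕ × ℕ)
abbrev Rcd := List Ent1 × List Ent2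

def encPair : ℕ × ℕ → List Bool := encProd encNat encNat
def encTriple : ℕ × ℕ × ℕ → List Bool := encProd encNat encPair
def encEnt1 : Ent1 → List Bool :=
  encProd encNat (encProd encNat (encProd encNat (encProd encPair (encProd encNat
    (encList encTriple)))))
def encEnt2 : Ent2 → List Bool := encProd encNat (encProd encNat (encList encTriple))
def encRcd : Rcd → List Bool := encProd (encList encEnt1) (encList encEnt2)
def encLabel : List Rcd → List Bool := encList encRcd

lemma PF.pair : PF encPair := PF.nat.prod PF.nat
lemma PF.triple : PF encTriple := PF.nat.prod PF.pair
lemma PF.ent1 : PF encEnt1 :=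
  PF.nat.prod (PF.nat.prod (PF.nat.prod (PF.pair.prod (PF.nat.prod PF.triple.list))))
lemma PF.ent2 : PF encEnt2 := PF.nat.prod (PF.nat.prod PF.triple.list)
lemma PF.rcd : PF encRcd := PF.ent1.list.prod PF.ent2.list
lemma PF.label : PF encLabel := PF.rcd.list

lemma encTriple_length {N : ℕ} (hN : 2 ≤ N) (x : ℕ × ℕ × ℕ) (h1 : x.1 ≤ N) (h2 : x.2.1 ≤ N)
    (h3 : x.2.2 ≤ N) : (encTriple x).length ≤ 15 * Nat.log 2 N := by
  simp only [encTriple, encPair, encProd, List.length_append]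
  have := encNat_length hN h1
  have := encNat_length hN h2
  have := encNat_length hN h3
  omega

lemma encEnt1_length {N : ℕ} (hN : 2 ≤ N) (x : Ent1) (h1 : x.1 ≤ N) (h2 : x.2.1 ≤ N)
    (h3 : x.2.2.1 ≤ N) (h4 : x.2.2.2.1.1 ≤ N) (h5 : x.2.2.2.1.2 ≤ N) (h6 : x.2.2.2.2.1 ≤ N)
    (h7 : x.2.2.2.2.2.length ≤ 2)
    (h8 : ∀ y ∈ x.2.2.2.2.2, y.1 ≤ N ∧ y.2.1 ≤ N ∧ y.2.2 ≤ N) :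
    (encEnt1 x).length ≤ 63 * Nat.log 2 N := by
  simp only [encEnt1, encPair, encProd, List.length_append]
  have := encNat_length hN h1
  have := encNat_length hN h2
  have := encNat_length hN h3
  have := encNat_length hN h4
  have := encNat_length hN h5
  have := encNat_length hN h6
  have l := encList_length encTriple (15 * Nat.log 2 N) x.2.2.2.2.2
    fun y hy => encTriple_length hN y (h8 y hy).1 (h8 y hy).2.1 (h8 y hy).2.2
  have l2 := Nat.mul_le_mul_right (15 * Nat.log 2 N + 1) h7
  have h3 : 1 ≤ Nat.log 2 N := Nat.log_pos (by norm_num) hN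
  omega

lemma encEnt2_length {N : ℕ} (hN : 2 ≤ N) (x : Ent2) (h1 : x.1 ≤ N) (h2 : x.2.1 ≤ N)
    (h7 : x.2.2.length ≤ Nat.log 2 N + 1)
    (h8 : ∀ y ∈ x.2.2, y.1 ≤ N ∧ y.2.1 ≤ N ∧ y.2.2 ≤ N) :
    (encEnt2 x).length ≤ 43 * Nat.log 2 N ^ 2 := by
  simp only [encEnt2, encProd, List.length_append]
  have := encNat_length hN h1
  have := encNat_length hN h2
  have l := encList_length encTriple (15 * Nat.log 2 N) x.2.2
    fun y hy => encTriple_length hN y (h8 y hy).1 (h8 y hy).2.1 (h8 y hy).2.2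
  have l2 := Nat.mul_le_mul_right (15 * Nat.log 2 N + 1) h7
  have h3 : 1 ≤ Nat.log 2 N := Nat.log_pos (by norm_num) hN
  nlinarith

lemma encRcd_length {N : ℕ} (hN : 2 ≤ N) (x : Rcd) (h1 : x.1.length ≤ 2) (h2 : x.2.length ≤ 2)
    (h3 : ∀ y ∈ x.1, (encEnt1 y).length ≤ 63 * Nat.log 2 N)
    (h4 : ∀ y ∈ x.2, (encEnt2 y).length ≤ 43 * Nat.log 2 N ^ 2) :
    (encRcd x).length ≤ 218 * Nat.log 2 N ^ 2 := by
  simp only [encRcd, encProd, List.length_append]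
  have l := encList_length encEnt1 _ x.1 h3
  have l' := encList_length encEnt2 _ x.2 h4
  have l2 := Nat.mul_le_mul_right (63 * Nat.log 2 N + 1) h1
  have l3 := Nat.mul_le_mul_right (43 * Nat.log 2 N ^ 2 + 1) h2
  have h3 : 1 ≤ Nat.log 2 N := Nat.log_pos (by norm_num) hN
  nlinarith

lemma encLabel_length {N : ℕ} (hN : 2 ≤ N) (l : List Rcd) (h1 : l.length ≤ Nat.log 2 N + 1)
    (h2 : ∀ y ∈ l, (encRcd y).length ≤ 218 * Nat.log 2 N ^ 2) :
    (encLabel l).length ≤ 439 * Nat.log 2 N ^ 3 := by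
  have l1 := encList_length encRcd _ l h2
  have l2 := Nat.mul_le_mul_right (218 * Nat.log 2 N ^ 2 + 1) h1
  have h3 : 1 ≤ Nat.log 2 N := Nat.log_pos (by norm_num) hN
  unfold encLabel
  generalize Nat.log 2 N = L at *
  have h4 : 1 ≤ L ^ 2 := Nat.one_le_pow _ _ h3
  have h5 : L ^ 2 ≤ L ^ 3 := Nat.pow_le_pow_right h3 (by norm_num)
  have h6 : L ≤ L ^ 3 := by nlinarith
  have : (L + 1) * (218 * L ^ 2 + 1) = 218 * L ^ 3 + 218 * L ^ 2 + L + 1 := by ring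
  omega

end Encoding

section Records

variable {V : Type} {G : SimpleGraph V}

/-- One-level decoding relation. -/
inductive RStep (ru rv : Rcd) : ℕ → Prop
  | exit (e : Ent1) (he : e ∈ ru.1) (hn : ∀ f ∈ rv.1, f.1 ≠ e.1) : RStep ru rv e.2.1
  | fromz (f : Ent1) (h : ru.1 = []) (hf : f ∈ rv.1) : RStep ru rv f.2.2.1
  | up (e : Ent1) (f : Ent2) (q : ℕ × (ℕ × ℕ)) (he : e ∈ ru.1) (hf : f ∈ rv.2) (h1 : f.1 = e.1)
      (h2 : ∀ e' ∈ ru.1, e'.1 ≠ f.2.1) (hq : q ∈ e.2.2.2.2.2) (ht : ¬ TLTest q.2 f.2.2) :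
      RStep ru rv q.1
  | heavy (e : Ent1) (f : Ent2) (x : ℕ × ℕ × ℕ) (he : e ∈ ru.1) (hf : f ∈ rv.2) (h1 : f.1 = e.1)
      (h2 : ∀ e' ∈ ru.1, e'.1 ≠ f.2.1) (ht : ∀ q ∈ e.2.2.2.2.2, TLTest q.2 f.2.2)
      (hx : x ∈ f.2.2) (hx1 : x.1 = e.2.2.2.1.1) (hx2 : e.2.2.2.1.2 < x.2.1) :
      RStep ru rv e.2.2.2.2.1
  | light (e : Ent1) (f : Ent2) (x : ℕ × ℕ × ℕ) (he : e ∈ ru.1) (hf : f ∈ rv.2) (h1 : f.1 = e.1)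
      (h2 : ∀ e' ∈ ru.1, e'.1 ≠ f.2.1) (ht : ∀ q ∈ e.2.2.2.2.2, TLTest q.2 f.2.2)
      (hx : x ∈ f.2.2) (hx1 : x.1 = e.2.2.2.1.1) (hx2 : e.2.2.2.1.2 = x.2.1) :
      RStep ru rv x.2.2

open Classical in
/-- The signature of `u` at `z`. -/
noncomputable def sig [Fintype V] (G : SimpleGraph V) (z u : V) : Finset V :=
  Finset.univ.filter fun a => G.Adj a z ∧ u ∈ halfspaceW G a z

lemma mem_sig [Fintype V] {z u a : V} : a ∈ sig G z u ↔ G.Adj a z ∧ u ∈ halfspaceW G a z := by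
  simp [sig]

lemma sig_card [Fintype V] (hM : MedianGraph G) (hQ : CubeFree G) (z u : V) :
    (sig G z u).card ≤ 2 := by
  apply parents_card hM hQ z u
  intro y hy
  obtain ⟨h1, h2⟩ := mem_sig.1 hy
  rw [mem_W] at h2
  have := adj_dist_cases hM h1 u
  refine ⟨h1.symm, ?_⟩
  rw [G.dist_comm (u := y), G.dist_comm (u := z)]
  omega

lemma good_via {p : V → V → ℕ} (hc : G.Connected) {u g v : V} {q : ℕ}
    (h : GoodPort G p u g q) (hd : G.dist u v = G.dist u g + G.dist g v) : GoodPort G p u v q := by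
  obtain ⟨w, h1, h2, h3⟩ := h
  refine ⟨w, h1, ?_, h3⟩
  have t1 := hc.dist_triangle (u := w) (v := g) (w := v)
  have t2 := hc.dist_triangle (u := u) (v := w) (w := v)
  have := SimpleGraph.dist_eq_one_iff_adj.2 h1
  omega

lemma record_exists [Fintype V] (hM : MedianGraph G) (hQ : CubeFree G) (hN : 2 ≤ Fintype.card V)
    (p : V → V → ℕ) (hp : ∀ u w, G.Adj u w → p u w ≤ Fintype.card V) (z : V) :
    ∃ R : V → Rcd,
      (∀ u, (encRcd (R u)).length ≤ 218 * Nat.log 2 (Fintype.card V) ^ 2) ∧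
      (∀ u v, sig G z u = sig G z v ↔ ∀ i, (∃ e ∈ (R u).1, e.1 = i) ↔ (∃ e ∈ (R v).1, e.1 = i)) ∧
      (∀ u v, sig G z u = sig G z v → ∀ q, ¬ RStep (R u) (R v) q) ∧
      (∀ u v, sig G z u ≠ sig G z v → ∃ q, RStep (R u) (R v) q) ∧
      (∀ u v q, RStep (R u) (R v) q → GoodPort G p u v q) := by
  classical
  set n := Fintype.card V with hn
  let idn : V → ℕ := fun v => (Fintype.equivFin V v : ℕ) + 1
  have idn_le : ∀ v, idn v ≤ n := fun v => (Fintype.equivFin V v).2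
  have idn_inj : ∀ {u v}, idn u = idn v → u = v := by
    intro u v h
    apply (Fintype.equivFin V).injective
    apply Fin.ext
    simpa [idn] using h
  -- tree data
  have tree : ∀ a, ∃ (loc : V → ℕ × ℕ) (hv : V → ℕ) (TL : V → ℕ → List (ℕ × ℕ × ℕ)),
      (∀ u, (loc u).1 ≤ n ∧ (loc u).2 ≤ n) ∧
      (∀ u, hv u ≤ n) ∧
      (∀ g q, q ≤ n → (TL g q).length ≤ Nat.log 2 n + 1 ∧
        ∀ x ∈ TL g q, x.1 ≤ n ∧ x.2.1 ≤ n ∧ x.2.2 ≤ n) ∧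
      (G.Adj a z → (∀ g ∈ bTree G z a, ∀ q r, TLTest (loc r) (TL g q) ↔ r ∈ gInterval G a g) ∧
      (∀ g ∈ bTree G z a, ∀ q, ∀ u ∈ gInterval G a g, ∀ x ∈ TL g q, x.1 = (loc u).1 →
        ((loc u).2 < x.2.1 → GoodPort G p u g (hv u)) ∧
        ((loc u).2 = x.2.1 → (u = g → x.2.2 = q) ∧ (u ≠ g → GoodPort G p u g x.2.2)))) := by
    intro a
    by_cases ha : G.Adj a z
    · obtain ⟨loc, hv, TL, h1, h2, h3, h4, h5⟩ := tree_labels hM.1 p hp a (bTree G z a)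
        (fun t ht x hx => bTree_down hM ha ht hx) (bTree_chain hM hQ ha)
      exact ⟨loc, hv, TL, h1, h2, h3, fun _ => ⟨h4, h5⟩⟩
    · exact ⟨fun _ => (0, 0), fun _ => 0, fun _ _ => [], by simp, by simp, by simp,
        fun h => absurd h ha⟩
  choose loc hv TL loc_le hv_le TL_le hT using tree
  -- exit ports
  have exits : ∀ u a, ∃ q, q ≤ n ∧ (a ∈ sig G z u → ∀ v, a ∉ sig G z v → GoodPort G p u v q) := by
    intro u a
    by_cases h : a ∈ sig G z u
    · obtain ⟨h1, h2⟩ := mem_sig.1 h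
      obtain ⟨w, w1, w2⟩ := exit_port hM h1 h2
      refine ⟨p u w, hp _ _ w1, fun _ v hv => ⟨w, w1, w2 v fun hv' => hv (mem_sig.2 ⟨h1, hv'⟩), rfl⟩⟩
    · exact ⟨0, Nat.zero_le _, fun h' => absurd h' h⟩
  choose ex ex_le ex_good using exits
  -- ports of z
  have zports : ∀ a, ∃ q, q ≤ n ∧ (G.Adj a z → q = p z a) := by
    intro a
    by_cases h : G.Adj a z
    · exact ⟨p z a, hp _ _ h.symm, fun _ => rfl⟩
    · exact ⟨0, Nat.zero_le _, fun h' => absurd h' h⟩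
  choose zp zp_le zp_eq using zports
  -- gates
  have gates : ∀ v b, ∃ g q, q ≤ n ∧ (b ∈ sig G z v →
      (∀ u, b ∉ sig G z u → G.dist u v = G.dist u g + G.dist g v) ∧ GoodPort G p g v q ∧
      ∀ a ∈ sig G z v, a ≠ b → g ∈ bTree G z a) := by
    intro v b
    by_cases h : b ∈ sig G z v
    · obtain ⟨hbz, h2⟩ := mem_sig.1 h
      obtain ⟨g, g', k1, k2, k3, k4, k5⟩ := gate_out hM hbz h2
      refine ⟨g, p g g', hp _ _ k1, fun _ => ⟨fun u hu => k4 u fun h' => hu (mem_sig.2 ⟨hbz, h'⟩),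
        ⟨g', k1, k5, rfl⟩, ?_⟩⟩
      intro a ha hab
      obtain ⟨haz, hva⟩ := mem_sig.1 ha
      have dab : G.dist a b = 2 := dist_two hM haz.symm hbz.symm hab
      have daz : G.dist a z = 1 := SimpleGraph.dist_eq_one_iff_adj.2 haz
      have haW : a ∈ halfspaceW G a z := by rw [mem_W, SimpleGraph.dist_self]; omega
      have haB : a ∉ halfspaceW G b z := by rw [mem_W]; omega
      have hgA : g ∈ halfspaceW G a z :=
        W_convex hM haz a haW v hva (by rw [mem_gInt]; exact (k4 a haB).symm)
      refine ⟨hgA, b, hbz, k3, g', k2, W_convex hM haz g hgA v hva ?_, k1⟩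
      rw [mem_gInt, SimpleGraph.dist_eq_one_iff_adj.2 k1]
      omega
    · exact ⟨v, 0, Nat.zero_le _, fun h' => absurd h' h⟩
  choose gt gq gq_le gt_spec using gates
  -- test vertices
  have tests : ∀ a u P, ∃ r, G.Adj u P → G.dist P a + 1 = G.dist u a →
      ∀ g, g ∈ halfspaceW G u P ↔ r ∈ gInterval G a g := by
    intro a u P
    by_cases h : G.Adj u P ∧ G.dist P a + 1 = G.dist u a
    · obtain ⟨r, hr⟩ := test_vertex hM h.1 h.2
      exact ⟨r, fun _ _ => hr⟩
    · exact ⟨a, fun h1 h2 => absurd ⟨h1, h2⟩ h⟩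
  choose rt rt_spec using tests
  let par : V → V → Finset V := fun a u =>
    Finset.univ.filter fun P => G.Adj u P ∧ G.dist P a + 1 = G.dist u a
  have mem_par : ∀ {a u P}, P ∈ par a u ↔ G.Adj u P ∧ G.dist P a + 1 = G.dist u a := by
    intro a u P; simp [par]
  let mk1 : V → V → Ent1 := fun u a => (idn a, ex u a, zp a, loc a u, hv a u,
    (par a u).toList.map fun P => (p u P, loc a (rt a u P)))
  let mk2 : V → V × V → Ent2 := fun v ab => (idn ab.1, idn ab.2, TL ab.1 (gt v ab.2) (gq v ab.2))
  let R : V → Rcd := fun u => ((sig G z u).toList.map (mk1 u), (sig G z u).offDiag.toList.map (mk2 u))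
  have mem1 : ∀ {u e}, e ∈ (R u).1 ↔ ∃ a ∈ sig G z u, mk1 u a = e := by
    intro u e; simp [R]
  have mem2 : ∀ {u e}, e ∈ (R u).2 ↔ ∃ a b, (a ∈ sig G z u ∧ b ∈ sig G z u ∧ a ≠ b) ∧
      mk2 u (a, b) = e := by
    intro u e; simp [R]
  have ids : ∀ u a, (∃ e ∈ (R u).1, e.1 = idn a) ↔ a ∈ sig G z u := by
    intro u a
    constructor
    · rintro ⟨e, he, h⟩
      obtain ⟨b, hb, rfl⟩ := mem1.1 he
      have := idn_inj h
      exact this ▸ hb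
    · intro h
      exact ⟨_, mem1.2 ⟨a, h, rfl⟩, rfl⟩
  have memq : ∀ {u a q}, q ∈ (mk1 u a).2.2.2.2.2 ↔ ∃ P ∈ par a u, (p u P, loc a (rt a u P)) = q := by
    intro u a q; simp [mk1]
  -- semantic unpacking of the descending case
  have sem : ∀ u v a b, a ∈ sig G z u → a ∈ sig G z v → b ∈ sig G z v → b ∉ sig G z u →
      a ≠ b → (∀ q ∈ (mk1 u a).2.2.2.2.2, TLTest q.2 (TL a (gt v b) (gq v b))) →
      u ∈ gInterval G a (gt v b) := by
    intro u v a b hau hav hbv hbu hab ht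
    have hg := (gt_spec v b hbv).2.2 a hav hab
    have haz := (mem_sig.1 hau).1
    obtain ⟨m, ⟨h1, h2, h3⟩, -⟩ := hM.2 u a (gt v b)
    by_cases hm : u = m
    · rw [hm]; exact h2
    exfalso
    obtain ⟨P, P1, P2⟩ := step_exists hM.1 hm
    rw [mem_gInt] at h1 h2 h3
    have e1 := SimpleGraph.dist_eq_one_iff_adj.2 P1
    have t1 := hM.1.dist_triangle (u := P) (v := m) (w := a)
    have t2 := hM.1.dist_triangle (u := u) (v := P) (w := a)
    have t3 := hM.1.dist_triangle (u := P) (v := m) (w := gt v b)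
    rw [G.dist_comm (u := gt v b) (v := m), G.dist_comm (u := m) (v := u),
      G.dist_comm (u := gt v b) (v := u)] at h3
    have hPar : P ∈ par a u := mem_par.2 ⟨P1, by omega⟩
    have hW := (rt_spec a u P P1 (by omega) (gt v b)).2
      (((hT a haz).1 _ hg _ _).1 (ht _ (memq.2 ⟨P, hPar, rfl⟩)))
    rw [mem_W, G.dist_comm, G.dist_comm (u := gt v b) (v := P)] at hW
    omega
  refine ⟨R, ?_, ?_, ?_, ?_, ?_⟩
  · intro u
    have hcard := sig_card hM hQ z u
    apply encRcd_length hN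
    · simpa [R] using hcard
    · simp only [R, List.length_map, Finset.length_toList, Finset.offDiag_card]
      interval_cases (sig G z u).card <;> simp
    · intro e he
      obtain ⟨a, ha, rfl⟩ := mem1.1 he
      refine encEnt1_length hN _ (idn_le _) (ex_le _ _) (zp_le _) (loc_le _ _).1 (loc_le _ _).2
        (hv_le _ _) ?_ ?_
      · simp only [mk1, List.length_map, Finset.length_toList]
        exact parents_card hM hQ u a _ fun y hy => mem_par.1 hy
      · intro y hy
        obtain ⟨P, hP, rfl⟩ := memq.1 hy
        exact ⟨hp _ _ (mem_par.1 hP).1, loc_le _ _⟩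
    · intro e he
      obtain ⟨a, b, -, rfl⟩ := mem2.1 he
      exact encEnt2_length hN _ (idn_le _) (idn_le _) (TL_le _ _ _ (gq_le _ _)).1
        (TL_le _ _ _ (gq_le _ _)).2
  · intro u v
    constructor
    · intro h i
      constructor
      · rintro ⟨e, he, rfl⟩
        obtain ⟨a, ha, rfl⟩ := mem1.1 he
        exact (ids v a).2 (h ▸ ha)
      · rintro ⟨e, he, rfl⟩
        obtain ⟨a, ha, rfl⟩ := mem1.1 he
        exact (ids u a).2 (h ▸ ha)
    · intro h
      ext a
      rw [← ids u a, ← ids v a]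
      exact h _
  · intro u v h q hq
    cases hq with
    | exit e he hn =>
      obtain ⟨a, ha, rfl⟩ := mem1.1 he
      obtain ⟨f, hf, hf'⟩ := (ids v a).2 (h ▸ ha)
      exact hn f hf hf'
    | fromz f h0 hf =>
      obtain ⟨a, ha, rfl⟩ := mem1.1 hf
      obtain ⟨f, hf, hf'⟩ := (ids u a).2 (h ▸ ha)
      rw [h0] at hf
      simp at hf
    | up e f q he hf h1 h2 =>
      obtain ⟨a, b, ⟨-, hb, -⟩, rfl⟩ := mem2.1 hf
      obtain ⟨f, hf, hf'⟩ := (ids u b).2 (h ▸ hb)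
      exact h2 f hf hf'
    | heavy e f x he hf h1 h2 =>
      obtain ⟨a, b, ⟨-, hb, -⟩, rfl⟩ := mem2.1 hf
      obtain ⟨f, hf, hf'⟩ := (ids u b).2 (h ▸ hb)
      exact h2 f hf hf'
    | light e f x he hf h1 h2 =>
      obtain ⟨a, b, ⟨-, hb, -⟩, rfl⟩ := mem2.1 hf
      obtain ⟨f, hf, hf'⟩ := (ids u b).2 (h ▸ hb)
      exact h2 f hf hf'
  · intro u v hne
    by_cases hsub : sig G z u ⊆ sig G z v
    · obtain ⟨b, hbv, hbu⟩ : ∃ b ∈ sig G z v, b ∉ sig G z u := by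
        by_contra hcon
        push Not at hcon
        exact hne (Finset.Subset.antisymm hsub hcon)
      by_cases hemp : sig G z u = ∅
      · exact ⟨_, RStep.fromz (mk1 v b) (by simp [R, hemp]) (mem1.2 ⟨b, hbv, rfl⟩)⟩
      obtain ⟨a, hau⟩ := Finset.nonempty_iff_ne_empty.2 hemp
      have hav := hsub hau
      have hab : a ≠ b := by rintro rfl; exact hbu hau
      have he : mk1 u a ∈ (R u).1 := mem1.2 ⟨a, hau, rfl⟩
      have hf : mk2 v (a, b) ∈ (R v).2 := mem2.2 ⟨a, b, ⟨hav, hbv, hab⟩, rfl⟩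
      have h2 : ∀ e' ∈ (R u).1, e'.1 ≠ (mk2 v (a, b)).2.1 :=
        fun e' he' h => hbu ((ids u b).1 ⟨e', he', h⟩)
      by_cases ht : ∀ q ∈ (mk1 u a).2.2.2.2.2, TLTest q.2 (TL a (gt v b) (gq v b))
      · have hu := sem u v a b hau hav hbv hbu hab ht
        have hg := (gt_spec v b hbv).2.2 a hav hab
        obtain ⟨x, hx, hx1, hx2⟩ := ((hT a (mem_sig.1 hau).1).1 _ hg (gq v b) u).2 hu
        rcases lt_or_eq_of_le hx2 with hlt | heq
        · exact ⟨_, RStep.heavy (mk1 u a) (mk2 v (a, b)) x he hf rfl h2 ht hx hx1 hlt⟩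
        · exact ⟨_, RStep.light (mk1 u a) (mk2 v (a, b)) x he hf rfl h2 ht hx hx1 heq⟩
      · push Not at ht
        obtain ⟨q, hq, hqt⟩ := ht
        exact ⟨_, RStep.up (mk1 u a) (mk2 v (a, b)) q he hf rfl h2 hq hqt⟩
    · obtain ⟨a, hau, hav⟩ := Finset.not_subset.1 hsub
      exact ⟨_, RStep.exit (mk1 u a) (mem1.2 ⟨a, hau, rfl⟩)
        fun f hf h => hav ((ids v a).1 ⟨f, hf, h⟩)⟩
  · -- soundness
    have unpack : ∀ u v e f, e ∈ (R u).1 → f ∈ (R v).2 → f.1 = e.1 →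
        (∀ e' ∈ (R u).1, e'.1 ≠ f.2.1) → ∃ a b, a ∈ sig G z u ∧ a ∈ sig G z v ∧ b ∈ sig G z v ∧
          b ∉ sig G z u ∧ a ≠ b ∧ e = mk1 u a ∧ f = mk2 v (a, b) := by
      intro u v e f he hf h1 h2
      obtain ⟨a, b, ⟨ha, hb, hab⟩, rfl⟩ := mem2.1 hf
      obtain ⟨a', ha', rfl⟩ := mem1.1 he
      have : a = a' := idn_inj h1
      subst this
      refine ⟨a, b, ha', ha, hb, ?_, hab, rfl, rfl⟩
      intro hbu
      obtain ⟨f, hf, hf'⟩ := (ids u b).2 hbu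
      exact h2 f hf hf'
    intro u v q hq
    cases hq with
    | exit e he hn =>
      obtain ⟨a, ha, rfl⟩ := mem1.1 he
      refine ex_good u a ha v fun hv => ?_
      obtain ⟨f, hf, hf'⟩ := (ids v a).2 hv
      exact hn f hf hf'
    | fromz f h0 hf =>
      obtain ⟨a, ha, rfl⟩ := mem1.1 hf
      obtain ⟨haz, hva⟩ := mem_sig.1 ha
      have huz : u = z := by
        by_contra hne
        obtain ⟨b, b1, b2⟩ := step_exists hM.1 (Ne.symm hne)
        have hb : b ∈ sig G z u := by
          refine mem_sig.2 ⟨b1.symm, ?_⟩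
          rw [mem_W, G.dist_comm, G.dist_comm (u := u)]
          omega
        obtain ⟨f, hf, hf'⟩ := (ids u b).2 hb
        rw [h0] at hf
        simp at hf
      subst huz
      refine ⟨a, haz.symm, ?_, zp_eq a haz⟩
      rw [mem_W] at hva
      have := adj_dist_cases hM haz v
      rw [G.dist_comm, G.dist_comm (u := u)]
      omega
    | up e f q he hf h1 h2 hq ht =>
      obtain ⟨a, b, hau, hav, hbv, hbu, hab, rfl, rfl⟩ := unpack u v e f he hf h1 h2
      obtain ⟨s1, s2, s3⟩ := gt_spec v b hbv
      have hg := s3 a hav hab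
      obtain ⟨P, hP, rfl⟩ := memq.1 hq
      obtain ⟨P1, P2⟩ := mem_par.1 hP
      refine good_via hM.1 ⟨P, P1, ?_, rfl⟩ (s1 u hbu)
      have hW : gt v b ∉ halfspaceW G u P := fun hW =>
        ht (((hT a (mem_sig.1 hau).1).1 _ hg _ _).2 ((rt_spec a u P P1 P2 _).1 hW))
      rw [mem_W] at hW
      have := adj_dist_cases hM P1 (gt v b)
      rw [G.dist_comm, G.dist_comm (u := u)]
      omega
    | heavy e f x he hf h1 h2 ht hx hx1 hx2 =>
      obtain ⟨a, b, hau, hav, hbv, hbu, hab, rfl, rfl⟩ := unpack u v e f he hf h1 h2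
      obtain ⟨s1, s2, s3⟩ := gt_spec v b hbv
      have hg := s3 a hav hab
      have hu := sem u v a b hau hav hbv hbu hab ht
      exact good_via hM.1 (((hT a (mem_sig.1 hau).1).2 _ hg _ u hu x hx hx1).1 hx2) (s1 u hbu)
    | light e f x he hf h1 h2 ht hx hx1 hx2 =>
      obtain ⟨a, b, hau, hav, hbv, hbu, hab, rfl, rfl⟩ := unpack u v e f he hf h1 h2
      obtain ⟨s1, s2, s3⟩ := gt_spec v b hbv
      have hg := s3 a hav hab
      have hu := sem u v a b hau hav hbv hbu hab ht
      obtain ⟨k1, k2⟩ := ((hT a (mem_sig.1 hau).1).2 _ hg _ u hu x hx hx1).2 hx2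
      by_cases hug : u = gt v b
      · rw [k1 hug]
        have := s2
        rw [← hug] at this
        exact this
      · exact good_via hM.1 (k2 hug) (s1 u hbu)

end Records

section Recursion

variable {V : Type} {G : SimpleGraph V}

/-- The full decoding relation. -/
inductive ROut : List Rcd → List Rcd → ℕ → Prop
  | here (ru rv : Rcd) (lu lv : List Rcd) (q : ℕ) (h : RStep ru rv q) :
      ROut (ru :: lu) (rv :: lv) q
  | there (ru rv : Rcd) (lu lv : List Rcd) (q : ℕ)
      (hs : ∀ i, (∃ e ∈ ru.1, e.1 = i) ↔ (∃ e ∈ rv.1, e.1 = i)) (h : ROut lu lv q) :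
      ROut (ru :: lu) (rv :: lv) q

lemma centroid [Fintype V] [DecidableEq V] (hM : MedianGraph G) (S : Finset V) (hS : S.Nonempty)
    (hconv : GConvex G (S : Set V)) :
    ∃ z ∈ S, ∀ u ∈ S, ∀ a ∈ sig G z u,
      2 * (S.filter fun w => sig G z w = sig G z u).card ≤ S.card := by
  classical
  obtain ⟨z, hz, hmin⟩ := Finset.exists_min_image S (fun z => ∑ s ∈ S, G.dist s z) hS
  refine ⟨z, hz, fun u hu a ha => ?_⟩
  obtain ⟨haz, hua⟩ := mem_sig.1 ha
  have haS : a ∈ S := by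
    refine hconv z hz u hu ?_
    rw [mem_gInt, SimpleGraph.dist_eq_one_iff_adj.2 haz.symm, G.dist_comm, G.dist_comm (u := z)]
    rw [mem_W] at hua
    have := adj_dist_cases hM haz u
    omega
  have hle := hmin a haS
  set A := S.filter fun w => w ∈ halfspaceW G a z with hA
  set B := S.filter fun w => ¬ w ∈ halfspaceW G a z with hB
  have hAB : A.card + B.card = S.card := Finset.card_filter_add_card_filter_not _
  have e1 : ∑ s ∈ S, G.dist s z + B.card = ∑ s ∈ S, G.dist s a + A.card := by
    rw [hA, hB, Finset.card_filter, Finset.card_filter, ← Finset.sum_add_distrib,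
      ← Finset.sum_add_distrib]
    apply Finset.sum_congr rfl
    intro s hs
    have := adj_dist_cases hM haz s
    by_cases h : s ∈ halfspaceW G a z
    · simp only [h, not_true_eq_false, if_true, if_false]
      rw [mem_W] at h; omega
    · simp only [h, not_false_eq_true, if_true, if_false]
      rw [mem_W] at h; omega
  have hsub : (S.filter fun w => sig G z w = sig G z u).card ≤ A.card := by
    apply Finset.card_le_card
    intro w hw
    rw [Finset.mem_filter] at hw ⊢
    refine ⟨hw.1, ?_⟩
    have : a ∈ sig G z w := by rw [hw.2]; exact ha
    exact (mem_sig.1 this).2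
  omega

lemma labels_exist [Fintype V] (hM : MedianGraph G) (hQ : CubeFree G) (hN : 2 ≤ Fintype.card V)
    (p : V → V → ℕ) (hp : ∀ u w, G.Adj u w → p u w ≤ Fintype.card V) (k : ℕ) :
    ∀ S : Finset V, GConvex G (S : Set V) → S.card < 2 ^ k →
    ∃ l : V → List Rcd, (∀ u, (l u).length ≤ k) ∧
      (∀ u, ∀ r ∈ l u, (encRcd r).length ≤ 218 * Nat.log 2 (Fintype.card V) ^ 2) ∧
      ∀ u ∈ S, ∀ v ∈ S, u ≠ v → (∃ q, ROut (l u) (l v) q) ∧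
        ∀ q, ROut (l u) (l v) q → GoodPort G p u v q := by
  classical
  induction k with
  | zero =>
    intro S _ hS
    have : S = ∅ := by simpa using hS
    subst this
    exact ⟨fun _ => [], by simp, by simp, by simp⟩
  | succ k ih =>
    intro S hconv hS
    rcases S.eq_empty_or_nonempty with rfl | hne
    · exact ⟨fun _ => [], by simp, by simp, by simp⟩
    obtain ⟨z, hz, hcen⟩ := centroid hM S hne hconv
    obtain ⟨R, R1, R2, R3, R4, R5⟩ := record_exists hM hQ hN p hp z
    have sub : ∀ σ : Finset V, ∃ l : V → List Rcd, (∀ u, (l u).length ≤ k) ∧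
        (∀ u, ∀ r ∈ l u, (encRcd r).length ≤ 218 * Nat.log 2 (Fintype.card V) ^ 2) ∧
        ∀ u ∈ S, ∀ v ∈ S, sig G z u = σ → sig G z v = σ → u ≠ v →
          (∃ q, ROut (l u) (l v) q) ∧ ∀ q, ROut (l u) (l v) q → GoodPort G p u v q := by
      intro σ
      by_cases hex : ∃ u ∈ S, sig G z u = σ ∧ σ.Nonempty
      · obtain ⟨u, hu, rfl, a, ha⟩ := hex
        have hc := hcen u hu a ha
        obtain ⟨l, l1, l2, l3⟩ := ih (S.filter fun w => sig G z w = sig G z u) (by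
            intro x hx y hy w hw
            simp only [Finset.coe_filter, Set.mem_ofPred_eq] at hx hy ⊢
            refine ⟨hconv x hx.1 y hy.1 hw, ?_⟩
            ext b
            constructor
            · intro hb
              obtain ⟨hbz, hwb⟩ := mem_sig.1 hb
              by_contra hbu
              have hbx : b ∉ sig G z x := by rw [hx.2]; exact hbu
              have hby : b ∉ sig G z y := by rw [hy.2]; exact hbu
              exact Wc_convex hM hbz (fun h => hbx (mem_sig.2 ⟨hbz, h⟩))
                (fun h => hby (mem_sig.2 ⟨hbz, h⟩)) hw hwb
            · intro hb
              have hbx : b ∈ sig G z x := by rw [hx.2]; exact hb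
              have hby : b ∈ sig G z y := by rw [hy.2]; exact hb
              have hbz := (mem_sig.1 hbx).1
              exact mem_sig.2 ⟨hbz, W_convex hM hbz x (mem_sig.1 hbx).2 y (mem_sig.1 hby).2 hw⟩)
          (by rw [pow_succ] at hS; omega)
        refine ⟨l, l1, l2, fun x hx y hy h1 h2 hxy => ?_⟩
        exact l3 x (Finset.mem_filter.2 ⟨hx, h1⟩) y (Finset.mem_filter.2 ⟨hy, h2⟩) hxy
      · refine ⟨fun _ => [], by simp, by simp, fun u hu v hv h1 h2 huv => ?_⟩
        exfalso
        have emp : ∀ u ∈ S, sig G z u = σ → u = z := by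
          intro u hu h1
          by_contra huz
          obtain ⟨b, b1, b2⟩ := step_exists hM.1 (Ne.symm huz)
          refine hex ⟨u, hu, h1, b, h1 ▸ mem_sig.2 ⟨b1.symm, ?_⟩⟩
          rw [mem_W, G.dist_comm, G.dist_comm (u := u)]
          omega
        exact huv ((emp u hu h1).trans (emp v hv h2).symm)
    choose l l1 l2 l3 using sub
    refine ⟨fun u => R u :: l (sig G z u) u, fun u => ?_, fun u r hr => ?_, fun u hu v hv huv => ?_⟩
    · simp only [List.length_cons]
      have := l1 (sig G z u) u
      omega
    · rcases List.mem_cons.1 hr with rfl | hr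
      · exact R1 u
      · exact l2 _ u r hr
    · by_cases hs : sig G z u = sig G z v
      · obtain ⟨⟨q, hq⟩, hall⟩ := l3 (sig G z u) u hu v hv rfl hs.symm huv
        beta_reduce
        rw [← hs]
        refine ⟨⟨q, ROut.there _ _ _ _ _ ((R2 u v).1 hs) hq⟩, fun q hq => ?_⟩
        cases hq with
        | here _ _ _ _ _ h => exact absurd h (R3 u v hs q)
        | there _ _ _ _ _ _ h => exact hall q h
      · obtain ⟨q, hq⟩ := R4 u v hs
        refine ⟨⟨q, ROut.here _ _ _ _ _ hq⟩, fun q hq => ?_⟩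
        cases hq with
        | here _ _ _ _ _ h => exact R5 u v q h
        | there _ _ _ _ _ h _ => exact absurd ((R2 u v).2 h) hs

open Classical in
/-- The universal decoder. -/
noncomputable def rDec (x : List Bool × List Bool) : ℕ :=
  if h : ∃ q lu lv, encLabel lu = x.1 ∧ encLabel lv = x.2 ∧ ROut lu lv q then h.choose else 0

lemma rDec_spec (lu lv : List Rcd) (h : ∃ q, ROut lu lv q) :
    ROut lu lv (rDec (encLabel lu, encLabel lv)) := by
  obtain ⟨q, hq⟩ := h
  have hex : ∃ q lu' lv', encLabel lu' = (encLabel lu, encLabel lv).1 ∧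
      encLabel lv' = (encLabel lu, encLabel lv).2 ∧ ROut lu' lv' q := ⟨q, lu, lv, rfl, rfl, hq⟩
  rw [rDec, dif_pos hex]
  obtain ⟨lu', lv', h1, h2, h3⟩ := hex.choose_spec
  have e1 := PF.label.inj h1
  have e2 := PF.label.inj h2
  subst e1 e2
  exact h3

end Recursion

/-- **Routing labeling scheme for cube-free median graphs.** There exist a constant
`C > 0` and a decoding function `D` such that every finite cube-free median graph on
`n ≥ 2` vertices, equipped with any port assignment, admits a labeling with labels of
length at most `C·(log₂ n)³` from which `D` computes, for any source `u` and distinct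
target `v`, the port from `u` to some neighbor of `u` lying on a shortest `(u,v)`-path. -/
theorem routing_labeling_cube_free_median :
    ∃ C : ℕ, 0 < C ∧ ∃ D : List Bool × List Bool → ℕ,
      ∀ (V : Type) [Fintype V] [DecidableEq V] (G : SimpleGraph V)
        [DecidableRel G.Adj],
        MedianGraph G → CubeFree G → 2 ≤ Fintype.card V →
        ∀ p : V → V → ℕ,
          (∀ u w : V, G.Adj u w → 1 ≤ p u w ∧ p u w ≤ G.degree u) →
          (∀ u w w' : V, G.Adj u w → G.Adj u w' → p u w = p u w' → w = w') →
          ∃ ℓ : V → List Bool,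
            (∀ v : V, (ℓ v).length ≤ C * (Nat.log 2 (Fintype.card V)) ^ 3) ∧
            (∀ u v : V, u ≠ v → ∃ w : V, G.Adj u w ∧
              G.dist w v = G.dist u v - 1 ∧ D (ℓ u, ℓ v) = p u w) := by
  refine ⟨439, by norm_num, rDec, ?_⟩
  intro V _ _ G _ hM hQ hN p hp _
  have hp' : ∀ u w, G.Adj u w → p u w ≤ Fintype.card V := fun u w h =>
    (hp u w h).2.trans (G.degree_lt_card_verts u).le
  obtain ⟨l, l1, l2, l3⟩ := labels_exist hM hQ hN p hp' (Nat.log 2 (Fintype.card V) + 1)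
    Finset.univ (fun _ _ _ _ _ _ => by simp)
    (by rw [Finset.card_univ]; exact Nat.lt_pow_succ_log_self (by norm_num) _)
  refine ⟨fun v => encLabel (l v), fun v => encLabel_length hN _ (l1 v) (l2 v), ?_⟩
  intro u v huv
  obtain ⟨hex, hall⟩ := l3 u (Finset.mem_univ _) v (Finset.mem_univ _) huv
  obtain ⟨w, w1, w2, w3⟩ := hall _ (rDec_spec _ _ hex)
  exact ⟨w, w1, by omega, w3⟩
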